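/- Let p ≥ 3 and (β,h) be a p-regular point with unique global maximizer m_* of H = H_{β,h,p}. Then there exist constants C > 0 and C' > 0 such that for all N ≥ 1, for both r ∈ {0,1}, and for all x ∈ [0, C·N^{1/6}], | P( (−1)^r (S_N − N m_*)/√(−N/H''(m_*)) > x ) / (1 − Φ(x)) − 1 | ≤ C'(1 + x^3)·N^{−1/2}. -/

import Mathlib

open Real MeasureTheory Filter
open scoped BigOperators Topology

noncomputable section

/-- The spin value (`±1`) of a Boolean coordinate. -/
def spin (b : Bool) : ℝ := if b then 1 else -1

/-- The total magnetization `S_N = ∑ᵢ Xᵢ` of a configuration. -/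
def mag {N : ℕ} (x : Fin N → Bool) : ℝ := ∑ i, spin (x i)

/-- The Hamiltonian of the `p`-spin Curie-Weiss model:
`β N^{1-p} ∑_{i₁,…,i_p} x_{i₁} ⋯ x_{i_p} + h ∑ᵢ xᵢ`. -/
def cwHamiltonian (p N : ℕ) (β h : ℝ) (x : Fin N → Bool) : ℝ :=
  β * (N : ℝ) ^ ((1 : ℤ) - (p : ℤ)) * (∑ i : Fin p → Fin N, ∏ j, spin (x (i j)))
    + h * mag x

/-- The (unnormalized) Gibbs weight of a configuration. -/
def cwWeight (p N : ℕ) (β h : ℝ) (x : Fin N → Bool) : ℝ :=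
  Real.exp (cwHamiltonian p N β h x)

/-- The probability of an event `E` under the `p`-spin Curie-Weiss measure `P_{β,h,p}`. -/
def cwProb (p N : ℕ) (β h : ℝ) (E : Set (Fin N → Bool)) : ℝ :=
  (∑ x : Fin N → Bool, E.indicator (cwWeight p N β h) x) /
    ∑ x : Fin N → Bool, cwWeight p N β h x

/-- Conditional probability of `E` given `A` under the `p`-spin Curie-Weiss measure. -/
def cwCondProb (p N : ℕ) (β h : ℝ) (E A : Set (Fin N → Bool)) : ℝ :=
  cwProb p N β h (E ∩ A) / cwProb p N β h A

/-- The binary entropy function `I(x) = ½[(1+x)log(1+x) + (1-x)log(1-x)]`. -/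
def binEnt (x : ℝ) : ℝ := (1/2) * ((1+x) * Real.log (1+x) + (1-x) * Real.log (1-x))

/-- The function `H_{β,h,p}(x) = βxᵖ + hx - I(x)`. -/
def Hfun (p : ℕ) (β h : ℝ) (x : ℝ) : ℝ := β * x ^ p + h * x - binEnt x

/-- `m` is a global maximizer of `H_{β,h,p}` on `[-1,1]`, lying in `(-1,1)`. -/
def isMaximizer (p : ℕ) (β h m : ℝ) : Prop :=
  m ∈ Set.Ioo (-1 : ℝ) 1 ∧ ∀ x ∈ Set.Icc (-1 : ℝ) 1, Hfun p β h x ≤ Hfun p β h m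

/-- `m` is the unique global maximizer of `H_{β,h,p}`. -/
def isUniqueMaximizer (p : ℕ) (β h m : ℝ) : Prop :=
  isMaximizer p β h m ∧ ∀ m', isMaximizer p β h m' → m' = m

/-- `(β,h)` is a `p`-regular point with unique global maximizer `m`. -/
def pRegular (p : ℕ) (β h m : ℝ) : Prop :=
  isUniqueMaximizer p β h m ∧ iteratedDeriv 2 (Hfun p β h) m < 0

/-- `(β,h)` is a `p`-special point with unique global maximizer `m`. -/
def pSpecial (p : ℕ) (β h m : ℝ) : Prop :=
  isUniqueMaximizer p β h m ∧ iteratedDeriv 2 (Hfun p β h) m = 0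

/-- `(β,h)` is a `p`-critical point: `H_{β,h,p}` has more than one global maximizer. -/
def pCritical (p : ℕ) (β h : ℝ) : Prop :=
  ∃ m₁ m₂, m₁ ≠ m₂ ∧ isMaximizer p β h m₁ ∧ isMaximizer p β h m₂

/-- The probability assigned to a set `S ⊆ ℝ` by the centered Gaussian with variance `v`. -/
def gaussProb (v : ℝ) (S : Set ℝ) : ℝ :=
  ∫ t in S, (Real.sqrt (2 * Real.pi * v))⁻¹ * Real.exp (-t ^ 2 / (2 * v))

/-- The CDF of the centered Gaussian with variance `v`. -/
def gaussCDF (v x : ℝ) : ℝ := gaussProb v (Set.Iic x)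

/-- The standard normal CDF `Φ`. -/
def stdNormCDF (x : ℝ) : ℝ := gaussCDF 1 x

/-- The CDF of the limit law `F` at a `p`-special point, where `c = H⁽⁴⁾(m_*)`:
`dF(x) = (2/Γ(1/4)) (-c/24)^{1/4} exp(c x⁴/24) dx`. -/
def specialCDF (c x : ℝ) : ℝ :=
  ∫ t in Set.Iic x, (2 / Real.Gamma (1/4)) * ((-c) / 24) ^ ((1:ℝ)/4) * Real.exp (c * t ^ 4 / 24)

/-- The inverse hyperbolic tangent `tanh⁻¹(t) = ½ log((1+t)/(1-t))`. -/
def arctanh (t : ℝ) : ℝ := (1/2) * Real.log ((1+t)/(1-t))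

/-- The function `g(t) = tanh⁻¹(t)/(p t^{p-1})`, so that the maximum pseudolikelihood
estimate of `β` is `g(X̄)`. -/
def gMPL (p : ℕ) (t : ℝ) : ℝ := arctanh t / (p * t ^ (p - 1))

/-- The threshold `β*(p) = inf{β ≥ 0 : sup_{x∈[0,1]} H_{β,0,p}(x) > 0}`. -/
def betaStar (p : ℕ) : ℝ := sInf {b : ℝ | 0 ≤ b ∧ ∃ x ∈ Set.Icc (0:ℝ) 1, 0 < Hfun p b 0 x}


/-- The total unnormalized Gibbs weight of the configurations with exactly `k` positive spins. -/
def magWeight (p N : ℕ) (β h : ℝ) (k : ℕ) : ℝ :=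
  N.choose k * Real.exp (N * (β * ((2 * k - N) / N : ℝ) ^ p + h * ((2 * k - N) / N : ℝ)))

lemma magWeight_nonneg (p N : ℕ) (β h : ℝ) (k : ℕ) : 0 ≤ magWeight p N β h k := by
  unfold magWeight; positivity

lemma mag_eq_card {N : ℕ} (x : Fin N → Bool) :
    mag x = 2 * (Finset.univ.filter (fun i => x i = true)).card - N := by
  have h1 : ∀ i, spin (x i) = 2 * (if x i = true then 1 else 0) - 1 := by
    intro i; unfold spin; split_ifs <;> norm_num
  unfold mag
  simp_rw [h1]
  rw [Finset.sum_sub_distrib, ← Finset.mul_sum, Finset.sum_boole]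
  simp

lemma sum_config_eq {N : ℕ} (F : ℝ → ℝ) :
    ∑ x : Fin N → Bool, F (mag x) =
      ∑ k ∈ Finset.range (N + 1), (N.choose k : ℝ) * F (2 * k - N) := by
  have h1 : ∑ x : Fin N → Bool, F (mag x) =
      ∑ s ∈ (Finset.univ : Finset (Fin N)).powerset, F (2 * (s.card : ℝ) - N) := by
    refine Finset.sum_nbij' (fun x => Finset.univ.filter (fun i => x i = true))
      (fun s i => decide (i ∈ s)) ?_ ?_ ?_ ?_ ?_
    · intro x _; simp
    · intro s _; simp
    · intro x _; ext i; simp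
    · intro s _; ext i; simp
    · intro x _; rw [mag_eq_card]
  rw [h1, Finset.sum_powerset_apply_card (fun n => F (2 * (n : ℝ) - N))]
  simp

lemma cwHamiltonian_eq {p N : ℕ} (hN : 1 ≤ N) (β h : ℝ) (x : Fin N → Bool) :
    cwHamiltonian p N β h x = N * (β * (mag x / N) ^ p + h * (mag x / N)) := by
  have hN' : (N : ℝ) ≠ 0 := by positivity
  have h1 : ∑ i : Fin p → Fin N, ∏ j, spin (x (i j)) = mag x ^ p := by
    unfold mag; rw [Fintype.sum_pow]
  unfold cwHamiltonian
  rw [h1, zpow_sub₀ hN', zpow_one, zpow_natCast, div_pow]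
  field_simp

lemma cwProb_eq {p N : ℕ} (hN : 1 ≤ N) (β h : ℝ) (P : ℝ → Prop) [DecidablePred P] :
    cwProb p N β h {σ | P (mag σ)} =
      (∑ k ∈ (Finset.range (N + 1)).filter (fun k : ℕ => P (2 * (k : ℝ) - N)), magWeight p N β h k) /
        ∑ k ∈ Finset.range (N + 1), magWeight p N β h k := by
  set E : ℝ → ℝ := fun M => Real.exp (N * (β * (M / N) ^ p + h * (M / N))) with hE
  have hw : ∀ x : Fin N → Bool, cwWeight p N β h x = E (mag x) := fun x => by
    rw [cwWeight, cwHamiltonian_eq hN]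
  unfold cwProb
  congr 1
  · have h1 : ∀ x : Fin N → Bool, Set.indicator {σ | P (mag σ)} (cwWeight p N β h) x =
        (fun M => if P M then E M else 0) (mag x) := by
      intro x
      simp only [Set.indicator_apply, Set.mem_ofPred_eq, hw]
    simp_rw [h1]
    rw [sum_config_eq (fun M => if P M then E M else 0), Finset.sum_filter]
    refine Finset.sum_congr rfl fun k _ => ?_
    split_ifs <;> simp [magWeight, hE]
  · simp_rw [hw]
    rw [sum_config_eq E]
    rfl

lemma log_stirlingSeq_sub_mono (n : ℕ) :
    Real.log (Stirling.stirlingSeq (n + 1)) - 1 / (12 * ((n : ℝ) + 1)) ≤ Real.log (√π) := by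
  have hmono : Monotone fun n : ℕ =>
      Real.log (Stirling.stirlingSeq (n + 1)) - 1 / (12 * ((n : ℝ) + 1)) := by
    refine monotone_nat_of_le_succ fun k => ?_
    have h1 := Stirling.log_stirlingSeq_sdiff_le (k + 1)
    have h2 : 1 / (12 * ((k + 1 : ℕ) : ℝ) * (((k + 1 : ℕ) : ℝ) + 1)) =
        1 / (12 * ((k : ℝ) + 1)) - 1 / (12 * (((k + 1 : ℕ) : ℝ) + 1)) := by
      push_cast; field_simp; ring
    rw [h2] at h1
    linarith
  have hlim : Tendsto (fun n : ℕ =>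
      Real.log (Stirling.stirlingSeq (n + 1)) - 1 / (12 * ((n : ℝ) + 1))) atTop
      (𝓝 (Real.log (√π) - 0)) := by
    refine Tendsto.sub ?_ ?_
    · exact ((Real.continuousAt_log (by positivity)).tendsto.comp
        Stirling.tendsto_stirlingSeq_sqrt_pi).comp (tendsto_add_atTop_nat 1)
    · have := tendsto_one_div_add_atTop_nhds_zero_nat (𝕜 := ℝ)
      have := this.const_mul (1 / 12)
      rw [mul_zero] at this
      refine this.congr fun k => ?_
      field_simp
  simpa using hmono.ge_of_tendsto hlim n

/-- Stirling's formula with an effective remainder. -/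
lemma abs_log_factorial_sub_le {n : ℕ} (hn : n ≠ 0) :
    |Real.log n.factorial - (n * Real.log n - n + 1 / 2 * Real.log (2 * n) + Real.log (√π))|
      ≤ 1 / n := by
  obtain ⟨k, rfl⟩ := Nat.exists_eq_succ_of_ne_zero hn
  have h1 := Stirling.log_stirlingSeq_formula (k + 1)
  have h2 := log_stirlingSeq_sub_mono k
  have h3 : Real.log (√π) ≤ Real.log (Stirling.stirlingSeq (k + 1)) :=
    Real.log_le_log (by positivity) (Stirling.sqrt_pi_le_stirlingSeq hn)
  have h4 : Real.log (((k + 1 : ℕ) : ℝ) / Real.exp 1) = Real.log ((k + 1 : ℕ) : ℝ) - 1 := by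
    rw [Real.log_div (by positivity) (by positivity), Real.log_exp]
  have h5 : 1 / (12 * ((k : ℝ) + 1)) ≤ 1 / ((k + 1 : ℕ) : ℝ) := by
    push_cast
    apply one_div_le_one_div_of_le <;> [positivity; nlinarith [Nat.cast_nonneg (α := ℝ) k]]
  rw [h4] at h1
  have h6 : (0 : ℝ) ≤ 1 / ((k + 1 : ℕ) : ℝ) := by positivity
  rw [abs_le]
  simp only [Nat.succ_eq_add_one] at *
  constructor <;> nlinarith

/-- Stirling's formula for binomial coefficients in terms of the binary entropy. -/
lemma abs_log_choose_sub_le {N k j : ℕ} (hk : k ≠ 0) (hj : j ≠ 0) (hN : k + j = N) {x : ℝ}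
    (hx : x = (2 * k - N) / N) :
    |Real.log (N.choose k) - (N * Real.log 2 - N * binEnt x - 1 / 2 * Real.log N
      - 1 / 2 * Real.log (1 - x ^ 2) + 1 / 2 * Real.log 2 - Real.log (√π))|
      ≤ 1 / N + 1 / k + 1 / j := by
  have hN0 : N ≠ 0 := by omega
  have hNr : (0 : ℝ) < N := by positivity
  have hkr : (0 : ℝ) < k := by positivity
  have hjr : (0 : ℝ) < j := by positivity
  have hsum : (k : ℝ) + j = N := by exact_mod_cast hN
  have a1 := abs_le.1 (abs_log_factorial_sub_le hN0)
  have a2 := abs_le.1 (abs_log_factorial_sub_le hk)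
  have a3 := abs_le.1 (abs_log_factorial_sub_le hj)
  have e0 : Real.log (N.choose k) =
      Real.log N.factorial - Real.log k.factorial - Real.log j.factorial := by
    have : (N.choose k : ℝ) = N.factorial / (k.factorial * j.factorial) := by
      have hkN : k ≤ N := by omega
      rw [Nat.cast_choose ℝ hkN]
      congr 3
      have : N - k = j := by omega
      rw [this]
    rw [this, Real.log_div (by positivity) (by positivity), Real.log_mul (by positivity)
      (by positivity)]
    ring
  have x1 : 1 + x = 2 * k / N := by rw [hx]; field_simp; ring
  have x2 : 1 - x = 2 * j / N := by rw [hx]; field_simp; linarith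
  have l1 : Real.log (1 + x) = Real.log 2 + Real.log k - Real.log N := by
    rw [x1, Real.log_div (by positivity) (by positivity), Real.log_mul (by positivity)
      (by positivity)]
  have l2 : Real.log (1 - x) = Real.log 2 + Real.log j - Real.log N := by
    rw [x2, Real.log_div (by positivity) (by positivity), Real.log_mul (by positivity)
      (by positivity)]
  have l3 : Real.log (1 - x ^ 2) = Real.log (1 + x) + Real.log (1 - x) := by
    rw [← Real.log_mul]
    · congr 1; ring
    · rw [x1]; positivity
    · rw [x2]; positivity
  have l4 : N * binEnt x = k * (Real.log 2 + Real.log k - Real.log N)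
      + j * (Real.log 2 + Real.log j - Real.log N) := by
    unfold binEnt
    rw [l1, l2, x1, x2]
    field_simp
  rw [Real.log_mul (by positivity) (by positivity)] at a1 a2 a3
  rw [e0, l4, l3, l1, l2]
  have s1 : N * Real.log N = k * Real.log N + j * Real.log N := by rw [← hsum]; ring
  have s2 : N * Real.log 2 = k * Real.log 2 + j * Real.log 2 := by rw [← hsum]; ring
  rw [abs_le]
  constructor <;> nlinarith

/-- The entropy bound for binomial coefficients. -/
lemma choose_le_exp_binEnt {N k : ℕ} (hN : 1 ≤ N) (hk : k ≤ N) :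
    (N.choose k : ℝ) ≤ Real.exp (N * Real.log 2 - N * binEnt ((2 * k - N) / N)) := by
  have hNr : (0 : ℝ) < N := by positivity
  obtain ⟨j, hj⟩ := Nat.exists_eq_add_of_le hk
  have hsum : (N : ℝ) = k + j := by exact_mod_cast hj
  set q : ℝ := k / N with hq
  have hq0 : 0 ≤ q := by positivity
  have hq1 : 1 - q = j / N := by rw [hq]; field_simp; linarith
  have hq1' : 0 ≤ 1 - q := by rw [hq1]; positivity
  have hbin : q ^ k * (1 - q) ^ j * N.choose k ≤ 1 := by
    have h1 := add_pow q (1 - q) N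
    have h2 : q + (1 - q) = 1 := by ring
    rw [h2, one_pow] at h1
    nth_rewrite 2 [h1]
    have h3 : N - k = j := by omega
    have := Finset.single_le_sum (f := fun m => q ^ m * (1 - q) ^ (N - m) * (N.choose m : ℝ))
      (s := Finset.range (N + 1)) (fun i _ => by positivity) (Finset.mem_range.2 (by omega : k < N + 1))
    simpa [h3] using this
  have hpow : ∀ (a : ℝ) (n : ℕ), 0 ≤ a → a = n / N →
      a ^ n = Real.exp (n * Real.log a) := by
    intro a n ha han
    rcases Nat.eq_zero_or_pos n with rfl | hn
    · simp
    · have : 0 < a := by rw [han]; positivity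
      rw [← Real.rpow_natCast, Real.rpow_def_of_pos this]; ring_nf
  rw [hpow q k hq0 hq, hpow (1 - q) j hq1' hq1, ← Real.exp_add] at hbin
  have hl : ∀ (a : ℝ) (n : ℕ), a = n / N → N * (2 * a * Real.log (2 * a)) =
      2 * (n * Real.log 2 + n * Real.log a) := by
    intro a n han
    rcases Nat.eq_zero_or_pos n with rfl | hn
    · simp [han]
    · have : 0 < a := by rw [han]; positivity
      rw [Real.log_mul (by norm_num) this.ne']
      have : N * a = n := by rw [han]; field_simp
      linear_combination 2 * (Real.log 2 + Real.log a) * this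
  have hI : N * Real.log 2 - N * binEnt ((2 * k - N) / N) =
      -(k * Real.log q + j * Real.log (1 - q)) := by
    have x1 : 1 + (2 * (k : ℝ) - N) / N = 2 * q := by rw [hq]; field_simp; ring
    have x2 : 1 - (2 * (k : ℝ) - N) / N = 2 * (1 - q) := by rw [hq]; field_simp; ring
    unfold binEnt
    rw [x1, x2]
    have e1 := hl q k hq
    have e2 := hl (1 - q) j hq1
    have s2 : N * Real.log 2 = k * Real.log 2 + j * Real.log 2 := by rw [hsum]; ring
    linarith
  rw [hI, Real.exp_neg, ← one_div, le_div_iff₀ (Real.exp_pos _)]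
  linarith

lemma magWeight_le {p N k : ℕ} (hN : 1 ≤ N) (hk : k ≤ N) (β h : ℝ) :
    magWeight p N β h k ≤ Real.exp (N * Real.log 2 + N * Hfun p β h ((2 * k - N) / N)) := by
  unfold magWeight
  calc _ ≤ Real.exp (N * Real.log 2 - N * binEnt ((2 * k - N) / N)) *
        Real.exp (N * (β * ((2 * k - N) / N : ℝ) ^ p + h * ((2 * k - N) / N : ℝ))) := by
        gcongr; exact choose_le_exp_binEnt hN hk
    _ = _ := by rw [← Real.exp_add]; congr 1; unfold Hfun; ring

lemma analyticAt_Hfun (p : ℕ) (β h : ℝ) {m : ℝ} (hm : m ∈ Set.Ioo (-1 : ℝ) 1) :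
    AnalyticAt ℝ (Hfun p β h) m := by
  have h1 : 0 < 1 + m := by linarith [hm.1]
  have h2 : 0 < 1 - m := by linarith [hm.2]
  unfold Hfun binEnt
  have a1 : AnalyticAt ℝ (fun x : ℝ => Real.log (1 + x)) m :=
    AnalyticAt.log (by fun_prop) h1
  have a2 : AnalyticAt ℝ (fun x : ℝ => Real.log (1 - x)) m :=
    AnalyticAt.log (by fun_prop) h2
  fun_prop

lemma continuous_Hfun (p : ℕ) (β h : ℝ) : Continuous (Hfun p β h) := by
  unfold Hfun binEnt
  have h1 : Continuous fun x : ℝ => (1 + x) * Real.log (1 + x) :=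
    Real.continuous_mul_log.comp (by fun_prop : Continuous fun x : ℝ => 1 + x)
  have h2 : Continuous fun x : ℝ => (1 - x) * Real.log (1 - x) :=
    Real.continuous_mul_log.comp (by fun_prop : Continuous fun x : ℝ => 1 - x)
  fun_prop

lemma exists_taylor_bound {f : ℝ → ℝ} {m : ℝ} (hf : AnalyticAt ℝ f m) (h1 : deriv f m = 0) :
    ∃ δ > 0, ∃ K > 0, ∀ x, |x - m| ≤ δ →
      |f x - f m - iteratedDeriv 2 f m / 2 * (x - m) ^ 2| ≤ K * |x - m| ^ 3 := by
  have hO := hf.hasFPowerSeriesAt.isBigO_sub_partialSum_pow 3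
  obtain ⟨K, hK, hb⟩ := hO.exists_pos
  rw [Asymptotics.isBigOWith_iff] at hb
  obtain ⟨δ, hδ, hball⟩ := Metric.eventually_nhds_iff.1 hb
  refine ⟨δ / 2, by positivity, K, hK, fun x hx => ?_⟩
  have := hball (y := x - m) (by rw [dist_zero_right, Real.norm_eq_abs]; linarith)
  simp only [FormalMultilinearSeries.partialSum, Finset.sum_range_succ, Finset.sum_range_zero,
    FormalMultilinearSeries.ofScalars_apply_eq, add_sub_cancel, iteratedDeriv_one, h1,
    iteratedDeriv_zero, Real.norm_eq_abs, abs_pow, abs_abs, smul_eq_mul] at this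
  convert this using 2
  simp [Nat.factorial]
  ring

lemma binEnt_neg (x : ℝ) : binEnt (-x) = binEnt x := by
  unfold binEnt
  rw [sub_neg_eq_add, ← sub_eq_add_neg]; ring

/-- The slope of the binary entropy at the endpoints of `[-1, 1]` is infinite. -/
lemma exists_binEnt_lt {M : ℝ} (hM : 0 < M) :
    ∃ t ∈ Set.Ioo (0 : ℝ) 1, binEnt (1 - t) + M * t < binEnt 1 := by
  refine ⟨Real.exp (-(2 * M)), ⟨Real.exp_pos _, by rw [Real.exp_lt_one_iff]; linarith⟩, ?_⟩
  set t := Real.exp (-(2 * M)) with ht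
  have ht0 : 0 < t := Real.exp_pos _
  have ht1 : t < 1 := by rw [ht, Real.exp_lt_one_iff]; linarith
  have hlog : Real.log t = -(2 * M) := by rw [ht, Real.log_exp]
  have h2 : Real.log (2 - t) ≤ Real.log 2 := Real.log_le_log (by linarith) (by linarith)
  have h3 : 0 < Real.log 2 := Real.log_pos (by norm_num)
  unfold binEnt
  have e1 : 1 + (1 - t) = 2 - t := by ring
  have e2 : 1 - (1 - t) = t := by ring
  have e3 : (1 : ℝ) + 1 = 2 := by norm_num
  rw [e1, e2, e3, hlog, sub_self, zero_mul]
  nlinarith [mul_le_mul_of_nonneg_left h2 (by linarith : 0 ≤ 2 - t), mul_pos ht0 h3]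

/-- A global maximizer of `Hfun` in `(-1, 1)` beats the endpoints strictly. -/
lemma Hfun_endpoint_lt {p : ℕ} {β h m : ℝ} (hβ : 0 < β) (hh : 0 < h)
    (hm : isMaximizer p β h m) {e : ℝ} (he : e = 1 ∨ e = -1) :
    Hfun p β h e < Hfun p β h m := by
  have hM : 0 < β * p + h := by positivity
  obtain ⟨t, ⟨ht0, ht1⟩, ht⟩ := exists_binEnt_lt hM
  have hpow : 1 - p * t ≤ (1 - t) ^ p := by
    have := one_add_mul_le_pow (a := -t) (by linarith) p
    simpa [sub_eq_add_neg] using this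
  have hpow1 : (1 - t) ^ p ≤ 1 := pow_le_one₀ (by linarith) (by linarith)
  have hbe : ∀ s, binEnt (e * s) = binEnt s := by
    intro s
    rcases he with rfl | rfl
    · simp
    · rw [neg_one_mul, binEnt_neg]
  have hmem : e * (1 - t) ∈ Set.Icc (-1 : ℝ) 1 := by
    rcases he with rfl | rfl <;> constructor <;> linarith
  refine lt_of_lt_of_le ?_ (hm.2 _ hmem)
  unfold Hfun
  have h1 := hbe 1
  rw [mul_one] at h1
  rw [h1, hbe, mul_pow]
  have hep : |e ^ p| = 1 := by
    rw [abs_pow]; rcases he with rfl | rfl <;> simp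
  have b1 : β * (e ^ p * (1 - (1 - t) ^ p)) ≤ β * (p * t) := by
    have : e ^ p * (1 - (1 - t) ^ p) ≤ p * t := by
      calc _ ≤ |e ^ p * (1 - (1 - t) ^ p)| := le_abs_self _
        _ = 1 - (1 - t) ^ p := by rw [abs_mul, hep, one_mul, abs_of_nonneg (by linarith)]
        _ ≤ p * t := by linarith
    exact mul_le_mul_of_nonneg_left this hβ.le
  have b2 : h * (e * t) ≤ h * t := by
    have : e * t ≤ t := by rcases he with rfl | rfl <;> linarith
    exact mul_le_mul_of_nonneg_left this hh.le
  nlinarith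

lemma exists_Hfun_gap {p : ℕ} {β h m : ℝ} (hβ : 0 < β) (hh : 0 < h)
    (hm : isUniqueMaximizer p β h m) {δ : ℝ} (hδ : 0 < δ) :
    ∃ ε > 0, ∀ x ∈ Set.Icc (-1 : ℝ) 1, δ ≤ |x - m| → Hfun p β h x ≤ Hfun p β h m - ε := by
  set S : Set ℝ := Set.Icc (-1 : ℝ) 1 ∩ {x | δ ≤ |x - m|} with hS
  have hcomp : IsCompact S := by
    refine isCompact_Icc.inter_right ?_
    exact isClosed_le continuous_const (by fun_prop)
  rcases S.eq_empty_or_nonempty with hemp | hne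
  · refine ⟨1, one_pos, fun x hx hd => ?_⟩
    have : x ∈ S := ⟨hx, hd⟩
    rw [hemp] at this
    exact this.elim
  · obtain ⟨z, hz, hmax⟩ := hcomp.exists_isMaxOn hne (continuous_Hfun p β h).continuousOn
    have hlt : Hfun p β h z < Hfun p β h m := by
      by_cases hz1 : z = 1 ∨ z = -1
      · exact Hfun_endpoint_lt hβ hh hm.1 hz1
      · push Not at hz1
        refine lt_of_le_of_ne (hm.1.2 z hz.1) fun heq => ?_
        have hzm : isMaximizer p β h z :=
          ⟨⟨lt_of_le_of_ne hz.1.1 (Ne.symm hz1.2), lt_of_le_of_ne hz.1.2 hz1.1⟩,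
            fun x hx => heq ▸ hm.1.2 x hx⟩
        have h0 := hz.2
        rw [hm.2 z hzm] at h0
        simp at h0
        linarith
    refine ⟨Hfun p β h m - Hfun p β h z, by linarith, fun x hx hd => ?_⟩
    have : Hfun p β h x ≤ Hfun p β h z := hmax ⟨hx, hd⟩
    linarith

/-- The constant in the local Gaussian approximation of `magWeight`. -/
def magConst (p N : ℕ) (β h m : ℝ) : ℝ :=
  Real.exp (N * Real.log 2 + N * Hfun p β h m - 1 / 2 * Real.log N - 1 / 2 * Real.log (1 - m ^ 2)
    + 1 / 2 * Real.log 2 - Real.log (√π))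

lemma abs_log_sub_log_le {x y c : ℝ} (hc : 0 < c) (hx : c ≤ x) (hy : c ≤ y) :
    |Real.log x - Real.log y| ≤ |x - y| / c := by
  have key : ∀ x y : ℝ, c ≤ x → c ≤ y → Real.log x - Real.log y ≤ |x - y| / c := by
    intro x y hx hy
    have hx0 : 0 < x := by linarith
    have hy0 : 0 < y := by linarith
    rw [← Real.log_div hx0.ne' hy0.ne']
    calc Real.log (x / y) ≤ x / y - 1 := Real.log_le_sub_one_of_pos (by positivity)
      _ = (x - y) / y := by field_simp
      _ ≤ |x - y| / y := by gcongr; exact le_abs_self _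
      _ ≤ |x - y| / c := by gcongr
  rw [abs_le]
  have h1 := key x y hx hy
  have h2 := key y x hy hx
  rw [abs_sub_comm] at h2
  constructor <;> linarith

lemma le_one_add_cube {t : ℝ} (ht : 0 ≤ t) : t ≤ 1 + t ^ 3 := by
  rcases le_total t 1 with h | h
  · have : 0 ≤ t ^ 3 := by positivity
    linarith
  · have : t ≤ t ^ 3 := le_self_pow₀ h (by norm_num)
    linarith

lemma le_one_sub_sq {z ρ : ℝ} (hρ : 0 ≤ ρ) (h : |z| ≤ 1 - ρ) : ρ ≤ 1 - z ^ 2 := by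
  rw [← sq_abs]
  nlinarith [abs_nonneg z]

set_option maxHeartbeats 400000 in
/-- Local Gaussian approximation of the law of the magnetization around the maximizer. -/
lemma exists_magWeight_local {p : ℕ} {β h m a : ℝ} (hm : isMaximizer p β h m) (ha : 0 < a)
    (ha2 : iteratedDeriv 2 (Hfun p β h) m = -a) :
    ∃ δ > 0, ∃ K > 0, ∀ N : ℕ, 1 ≤ N → ∀ k : ℕ, k ≤ N → ∀ y : ℝ,
      y = (2 * (k : ℝ) - N - N * m) / √(N / a) → |y| ≤ δ * √N →
      ∃ θ : ℝ, magWeight p N β h k = magConst p N β h m * Real.exp (-y ^ 2 / 2 + θ) ∧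
        |θ| ≤ K * (1 + |y| ^ 3) / √N := by
  have hderiv : deriv (Hfun p β h) m = 0 := by
    have : IsLocalMax (Hfun p β h) m := by
      filter_upwards [Icc_mem_nhds hm.1.1 hm.1.2] with x hx using hm.2 x hx
    exact this.deriv_eq_zero
  obtain ⟨δ0, hδ0, K0, hK0, hT⟩ := exists_taylor_bound (analyticAt_Hfun p β h hm.1) hderiv
  rw [ha2] at hT
  have hm1 : |m| < 1 := abs_lt.2 hm.1
  set ρ := (1 - |m|) / 2 with hρ
  have hρ0 : 0 < ρ := by rw [hρ]; linarith
  have hsa : 0 < √a := Real.sqrt_pos.2 ha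
  have hsa2 : √a * √a = a := Real.mul_self_sqrt ha.le
  set η := min δ0 ρ with hη
  have hη0 : 0 < η := lt_min hδ0 hρ0
  refine ⟨η * √a, by positivity, K0 / (a * √a) + 1 / (ρ * √a) + (1 + 4 / ρ), by positivity, ?_⟩
  intro N hN k hk y hy hyδ
  have hNr : (1 : ℝ) ≤ N := by exact_mod_cast hN
  have hN0 : (0 : ℝ) < N := by linarith
  have hsN : 0 < √(N : ℝ) := Real.sqrt_pos.2 hN0
  have hsN2 : √(N : ℝ) * √(N : ℝ) = N := Real.mul_self_sqrt hN0.le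
  have hsN1 : 1 ≤ √(N : ℝ) := Real.one_le_sqrt.2 hNr
  set x : ℝ := (2 * k - N) / N with hx
  set u := x - m with hu
  have hyu : y = u * (√a * √N) := by
    rw [hy, Real.sqrt_div hN0.le, hu, hx]
    field_simp
    rw [sq, hsN2]; ring
  have hyabs : |y| = |u| * (√a * √N) := by
    rw [hyu, abs_mul, abs_of_pos (by positivity : 0 < √a * √(N : ℝ))]
  have huη : |u| ≤ η := by
    rw [hyabs] at hyδ
    have : |u| * (√a * √N) ≤ η * (√a * √N) := by linarith
    exact le_of_mul_le_mul_right this (by positivity)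
  have huδ : |u| ≤ δ0 := huη.trans (min_le_left _ _)
  have huρ : |u| ≤ ρ := huη.trans (min_le_right _ _)
  have hxabs : |x| ≤ 1 - ρ := by
    have : |x| ≤ |u| + |m| := by
      have := abs_add_le u m
      rwa [hu, sub_add_cancel] at this
    have : |m| = 1 - 2 * ρ := by rw [hρ]; ring
    linarith
  have hx12 := abs_le.1 hxabs
  obtain ⟨j, hj⟩ := Nat.exists_eq_add_of_le hk
  have hsum : (N : ℝ) = k + j := by exact_mod_cast hj
  have hkx : 2 * (k : ℝ) = N * (1 + x) := by rw [hx]; field_simp; ring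
  have hjx : 2 * (j : ℝ) = N * (1 - x) := by rw [hx]; field_simp; linarith
  have hkρ : N * ρ / 2 ≤ (k : ℝ) := by
    have := mul_le_mul_of_nonneg_left (show ρ ≤ 1 + x by linarith [hx12.1]) hN0.le
    linarith
  have hjρ : N * ρ / 2 ≤ (j : ℝ) := by
    have := mul_le_mul_of_nonneg_left (show ρ ≤ 1 - x by linarith [hx12.2]) hN0.le
    linarith
  have hk0 : (0 : ℝ) < k := lt_of_lt_of_le (by positivity) hkρ
  have hj0 : (0 : ℝ) < j := lt_of_lt_of_le (by positivity) hjρ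
  have hS := abs_log_choose_sub_le (x := x) (Nat.cast_pos.1 hk0).ne' (Nat.cast_pos.1 hj0).ne'
    hj.symm hx
  have hinv : (1 : ℝ) / N + 1 / k + 1 / j ≤ (1 + 4 / ρ) / √N := by
    have e1 : (1 : ℝ) / k ≤ 1 / (N * ρ / 2) := one_div_le_one_div_of_le (by positivity) hkρ
    have e2 : (1 : ℝ) / j ≤ 1 / (N * ρ / 2) := one_div_le_one_div_of_le (by positivity) hjρ
    have e3 : (1 : ℝ) / (N * ρ / 2) = 2 / ρ / N := by field_simp
    have e4 : (1 + 4 / ρ) / N ≤ (1 + 4 / ρ) / √N := by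
      gcongr
      exact le_mul_of_one_le_left hsN.le hsN1 |>.trans_eq hsN2
    have e5 : (1 + 4 / ρ) / N = 1 / N + 2 / ρ / N + 2 / ρ / N := by ring
    linarith
  have hlog : |Real.log (1 - x ^ 2) - Real.log (1 - m ^ 2)| ≤ 2 * |u| / ρ := by
    have hmρ : |m| ≤ 1 - ρ := by
      have : |m| = 1 - 2 * ρ := by rw [hρ]; ring
      linarith
    refine (abs_log_sub_log_le hρ0 ?_ ?_).trans ?_
    · exact le_one_sub_sq hρ0.le hxabs
    · exact le_one_sub_sq hρ0.le hmρ
    · gcongr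
      have : 1 - x ^ 2 - (1 - m ^ 2) = -(u * (x + m)) := by rw [hu]; ring
      rw [this, abs_neg, abs_mul, mul_comm]
      gcongr
      exact (abs_add_le _ _).trans (by linarith)
  have hTx := hT x huδ
  have hw0 : 0 < magWeight p N β h k := by
    unfold magWeight
    have := Nat.choose_pos hk
    positivity
  have hlogw : Real.log (magWeight p N β h k) =
      Real.log (N.choose k) + N * (β * x ^ p + h * x) := by
    unfold magWeight
    rw [Real.log_mul, Real.log_exp]
    · have := Nat.choose_pos hk
      positivity
    · positivity
  refine ⟨Real.log (magWeight p N β h k) - Real.log (magConst p N β h m) + y ^ 2 / 2, ?_, ?_⟩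
  · have hA : 0 < magConst p N β h m := Real.exp_pos _
    have e : ∀ b c : ℝ, -y ^ 2 / 2 + (b - c + y ^ 2 / 2) = b - c := fun b c => by ring
    rw [e, Real.exp_sub, Real.exp_log hw0, Real.exp_log hA, mul_div_cancel₀ _ hA.ne']
  · have hy2 : y ^ 2 / 2 = N * (a / 2 * u ^ 2) := by
      rw [hyu]
      calc _ = u ^ 2 * (√a * √a) * (√(N : ℝ) * √(N : ℝ)) / 2 := by ring
        _ = _ := by rw [hsa2, hsN2]; ring
    have hdec : Real.log (magWeight p N β h k) - Real.log (magConst p N β h m) + y ^ 2 / 2 =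
        (Real.log (N.choose k) - (N * Real.log 2 - N * binEnt x - 1 / 2 * Real.log N
          - 1 / 2 * Real.log (1 - x ^ 2) + 1 / 2 * Real.log 2 - Real.log (√π)))
        + N * (Hfun p β h x - Hfun p β h m - -a / 2 * (x - m) ^ 2)
        - 1 / 2 * (Real.log (1 - x ^ 2) - Real.log (1 - m ^ 2)) := by
      rw [hlogw, hy2, magConst, Real.log_exp]
      have : Hfun p β h x = β * x ^ p + h * x - binEnt x := rfl
      rw [this]; ring
    rw [hdec]
    have b1 : |N * (Hfun p β h x - Hfun p β h m - -a / 2 * (x - m) ^ 2)| ≤ N * (K0 * |u| ^ 3) := by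
      rw [abs_mul, abs_of_pos hN0]
      gcongr
    have b2 : N * (K0 * |u| ^ 3) = K0 / (a * √a) * |y| ^ 3 / √N := by
      rw [hyabs]
      have : (|u| * (√a * √N)) ^ 3 = |u| ^ 3 * (√a * √a * √a) * (√(N : ℝ) * √(N : ℝ) * √(N : ℝ)) := by
        ring
      rw [this, hsa2, hsN2]
      field_simp
    have b3 : |u| / ρ = 1 / (ρ * √a) * |y| / √N := by
      rw [hyabs]; field_simp
    have hy13 : |y| ≤ 1 + |y| ^ 3 := le_one_add_cube (abs_nonneg y)
    have b4 : K0 / (a * √a) * |y| ^ 3 / √N ≤ K0 / (a * √a) * (1 + |y| ^ 3) / √N := by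
      gcongr; linarith
    have b5 : 1 / (ρ * √a) * |y| / √N ≤ 1 / (ρ * √a) * (1 + |y| ^ 3) / √N := by
      gcongr
    have b6 : (1 + 4 / ρ) / √N ≤ (1 + 4 / ρ) * (1 + |y| ^ 3) / √N := by
      gcongr
      have : (0 : ℝ) ≤ |y| ^ 3 := by positivity
      exact le_mul_of_one_le_right (by positivity) (by linarith)
    have b7 : (K0 / (a * √a) + 1 / (ρ * √a) + (1 + 4 / ρ)) * (1 + |y| ^ 3) / √N =
        K0 / (a * √a) * (1 + |y| ^ 3) / √N + 1 / (ρ * √a) * (1 + |y| ^ 3) / √N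
        + (1 + 4 / ρ) * (1 + |y| ^ 3) / √N := by ring
    rw [b7]
    have c1 := abs_le.1 (hS.trans hinv)
    have c2 := abs_le.1 b1
    have c3 := abs_le.1 hlog
    have c4 : 2 * |u| / ρ = 2 * (|u| / ρ) := by ring
    rw [abs_le]
    constructor <;> linarith

/-- Away from the maximizer, the weights are exponentially small. -/
lemma exists_magWeight_far {p : ℕ} {β h m a : ℝ} (hβ : 0 < β) (hh : 0 < h)
    (hm : isUniqueMaximizer p β h m) (ha : 0 < a) {δ : ℝ} (hδ : 0 < δ) :
    ∃ K > 0, ∃ c > 0, ∀ N : ℕ, 1 ≤ N → ∀ k : ℕ, k ≤ N → ∀ y : ℝ,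
      y = (2 * (k : ℝ) - N - N * m) / √(N / a) → δ * √N < |y| →
      magWeight p N β h k ≤ magConst p N β h m * (K * √N * Real.exp (-c * N)) := by
  have hsa : 0 < √a := Real.sqrt_pos.2 ha
  obtain ⟨ε, hε, hgap⟩ := exists_Hfun_gap hβ hh hm (δ := δ / √a) (by positivity)
  have hm2 : 0 < 1 - m ^ 2 := by nlinarith [hm.1.1.1, hm.1.1.2]
  refine ⟨√(1 - m ^ 2) * √π / √2, by positivity, ε, hε, ?_⟩
  intro N hN k hk y hy hyδ
  have hNr : (1 : ℝ) ≤ N := by exact_mod_cast hN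
  have hN0 : (0 : ℝ) < N := by linarith
  have hkN : (k : ℝ) ≤ N := by exact_mod_cast hk
  have hk0 : (0 : ℝ) ≤ k := by positivity
  have hsN : 0 < √(N : ℝ) := Real.sqrt_pos.2 hN0
  have hsN2 : √(N : ℝ) * √(N : ℝ) = N := Real.mul_self_sqrt hN0.le
  set x : ℝ := (2 * k - N) / N with hx
  have hyu : y = (x - m) * (√a * √N) := by
    rw [hy, Real.sqrt_div hN0.le, hx]
    field_simp
    rw [sq, hsN2]; ring
  have hxm : δ / √a ≤ |x - m| := by
    rw [hyu, abs_mul, abs_of_pos (by positivity : 0 < √a * √(N : ℝ))] at hyδ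
    rw [div_le_iff₀ hsa]
    have : δ * √N ≤ (|x - m| * √a) * √N := by linarith
    exact le_of_mul_le_mul_right this hsN
  have hx1 : x ∈ Set.Icc (-1 : ℝ) 1 := by
    rw [hx]
    constructor
    · rw [le_div_iff₀ hN0]; linarith
    · rw [div_le_iff₀ hN0]; linarith
  have hH := hgap x hx1 hxm
  refine (magWeight_le hN hk β h).trans ?_
  have hK : √(1 - m ^ 2) * √π / √2 * √N = Real.exp (1 / 2 * Real.log (1 - m ^ 2) +
      Real.log (√π) - 1 / 2 * Real.log 2 + 1 / 2 * Real.log N) := by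
    rw [Real.exp_add, Real.exp_sub, Real.exp_add, Real.exp_log (by positivity)]
    have hs : ∀ z : ℝ, 0 < z → Real.exp (1 / 2 * Real.log z) = √z := by
      intro z hz
      rw [Real.sqrt_eq_rpow, Real.rpow_def_of_pos hz]; ring_nf
    rw [hs _ hm2, hs _ two_pos, hs _ hN0]
  rw [hK, magConst, ← Real.exp_add, ← Real.exp_add]
  apply Real.exp_le_exp.2
  have := mul_le_mul_of_nonneg_left hH hN0.le
  nlinarith

lemma setIntegral_Ioi_shift (g : ℝ → ℝ) (c : ℝ) :
    ∫ u in Set.Ioi 0, g (c + u) = ∫ u in Set.Ioi c, g u := by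
  have h := (measurePreserving_add_left volume c).setIntegral_preimage_emb
    (measurableEmbedding_addLeft c) g (Set.Ioi c)
  simpa using h

lemma integrableOn_Ioi_shift {g : ℝ → ℝ} {c : ℝ} (hg : IntegrableOn g (Set.Ioi c)) :
    IntegrableOn (fun u => g (c + u)) (Set.Ioi 0) := by
  have h := (measurePreserving_add_left volume c).integrableOn_comp_preimage
    (measurableEmbedding_addLeft c) (f := g) (s := Set.Ioi c)
  have h2 := h.2 hg
  simpa [Function.comp_def] using h2

lemma setIntegral_Ioi_affine (g : ℝ → ℝ) (c : ℝ) {Δ : ℝ} (hΔ : 0 < Δ) :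
    Δ * ∫ t in Set.Ioi 0, g (c + Δ * t) = ∫ u in Set.Ioi c, g u := by
  have h := integral_comp_mul_left_Ioi (fun u => g (c + u)) 0 hΔ
  simp only [mul_zero, smul_eq_mul] at h
  rw [h, setIntegral_Ioi_shift, ← mul_assoc, mul_inv_cancel₀ hΔ.ne', one_mul]

lemma integrableOn_Ioi_affine {g : ℝ → ℝ} {c : ℝ} (hg : IntegrableOn g (Set.Ioi c)) {Δ : ℝ}
    (hΔ : 0 < Δ) : IntegrableOn (fun t => g (c + Δ * t)) (Set.Ioi 0) := by
  have h := (integrableOn_Ioi_comp_mul_left_iff (fun u => g (c + u)) 0 hΔ)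
  rw [mul_zero] at h
  exact h.2 (integrableOn_Ioi_shift hg)

lemma exists_first_pos {s0 Δ : ℝ} (hΔ : 0 < Δ) (hs0 : s0 ≤ 0) :
    ∃ k0 : ℕ, 0 < s0 + k0 * Δ ∧ s0 + k0 * Δ ≤ Δ ∧ ∀ k : ℕ, 0 < s0 + k * Δ → k0 ≤ k := by
  have hex : ∃ k : ℕ, 0 < s0 + k * Δ := by
    obtain ⟨k, hk⟩ := exists_nat_gt (-s0 / Δ)
    rw [div_lt_iff₀ hΔ] at hk
    exact ⟨k, by linarith⟩
  classical
  refine ⟨Nat.find hex, Nat.find_spec hex, ?_, fun k hk => Nat.find_min' hex hk⟩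
  rcases hn : Nat.find hex with _ | n
  · simp; linarith
  · have := Nat.find_min hex (show n < Nat.find hex by omega)
    push Not at this
    push_cast
    linarith

/-- Upper Riemann sum estimate along a lattice for an antitone function. -/
lemma lattice_sum_le {g : ℝ → ℝ} (hanti : AntitoneOn g (Set.Ici 0))
    (hint : IntegrableOn g (Set.Ioi 0)) (hnn : ∀ t, 0 ≤ t → 0 ≤ g t) {s0 Δ : ℝ} (hΔ : 0 < Δ)
    (hs0 : s0 ≤ 0) (F : Finset ℕ) (hF : ∀ k ∈ F, 0 < s0 + k * Δ) :
    Δ * ∑ k ∈ F, g (s0 + k * Δ) ≤ Δ * g 0 + ∫ t in Set.Ioi 0, g t := by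
  obtain ⟨k0, hpos, -, hmin⟩ := exists_first_pos hΔ hs0
  set c := s0 + k0 * Δ with hc
  set f : ℝ → ℝ := fun t => g (c + Δ * t) with hf
  have hfa : AntitoneOn f (Set.Ici 0) := by
    intro a ha b hb hab
    have ha' : (0 : ℝ) ≤ a := ha
    have hb' : (0 : ℝ) ≤ b := hb
    refine hanti ?_ ?_ ?_
    · simp only [Set.mem_Ici]; positivity
    · simp only [Set.mem_Ici]; positivity
    · gcongr
  have hintc : IntegrableOn g (Set.Ioi c) := hint.mono_set (Set.Ioi_subset_Ioi hpos.le)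
  have hfi : IntegrableOn f (Set.Ioi 0) := integrableOn_Ioi_affine hintc hΔ
  have hfn : ∀ t ∈ Set.Ioi (0 : ℝ), 0 ≤ f t := by
    intro t ht
    have ht' : (0 : ℝ) < t := ht
    exact hnn _ (by positivity)
  have hsm := hfa.summable_of_integrableOn_Ioi_zero hfi hfn
  have h1 := hfa.tsum_le_integral hfi hfn
  have h2 : ∑ k ∈ F, g (s0 + k * Δ) ≤ ∑' n : ℕ, f n := by
    have : ∑ k ∈ F, g (s0 + k * Δ) = ∑ i ∈ F.image (fun k => k - k0), f i := by
      rw [Finset.sum_image]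
      · refine Finset.sum_congr rfl fun k hk => ?_
        have := hmin k (hF k hk)
        rw [hf, hc]
        simp only
        congr 1
        rw [Nat.cast_sub this]; ring
      · intro a ha b hb hab
        have h1 := hmin a (hF a ha)
        have h2 := hmin b (hF b hb)
        simp only at hab
        omega
    rw [this]
    refine hsm.sum_le_tsum _ fun i _ => ?_
    exact hnn _ (by positivity)
  have h3 : f 0 ≤ g 0 := hanti (by simp) (by simp [hpos.le]) (by simp [hpos.le])
  have h4 : Δ * ∫ t in Set.Ioi 0, f t ≤ ∫ t in Set.Ioi 0, g t := by
    rw [hf, setIntegral_Ioi_affine g c hΔ]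
    refine setIntegral_mono_set hint ?_ (Set.Ioi_subset_Ioi hpos.le).eventuallyLE
    filter_upwards [ae_restrict_mem measurableSet_Ioi] with t ht
    exact hnn t (le_of_lt ht)
  nlinarith

/-- Lower Riemann sum estimate along a lattice for an antitone function. -/
lemma le_lattice_sum {g : ℝ → ℝ} (hanti : AntitoneOn g (Set.Ici 0))
    (hint : IntegrableOn g (Set.Ioi 0)) (hnn : ∀ t, 0 ≤ t → 0 ≤ g t) {s0 Δ ℓ : ℝ} (hΔ : 0 < Δ)
    (hs0 : s0 ≤ 0) (hℓ : 0 ≤ ℓ) (F : Finset ℕ) (hF0 : ∀ k ∈ F, 0 < s0 + k * Δ)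
    (hF : ∀ k : ℕ, 0 < s0 + k * Δ → s0 + k * Δ ≤ ℓ → k ∈ F) :
    ∫ t in Set.Ioi 0, g t ≤
      Δ * g 0 + Δ * ∑ k ∈ F, g (s0 + k * Δ) + ∫ t in Set.Ioi ℓ, g t := by
  obtain ⟨k0, hpos, hle, hmin⟩ := exists_first_pos hΔ hs0
  set c := s0 + k0 * Δ with hc
  set G : ℝ → ℝ := (Set.Iic ℓ).indicator g with hG
  have hGnn : ∀ t, 0 ≤ t → 0 ≤ G t := by
    intro t ht
    rw [hG, Set.indicator_apply]
    split_ifs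
    exacts [hnn t ht, le_rfl]
  have hGg : ∀ t, 0 ≤ t → G t ≤ g t := by
    intro t ht
    rw [hG, Set.indicator_apply]
    split_ifs
    exacts [le_rfl, hnn t ht]
  have hGa : AntitoneOn G (Set.Ici 0) := by
    intro a ha b hb hab
    by_cases hbl : b ≤ ℓ
    · have hal : a ≤ ℓ := hab.trans hbl
      rw [hG, Set.indicator_of_mem (Set.mem_Iic.2 hbl), Set.indicator_of_mem (Set.mem_Iic.2 hal)]
      exact hanti ha hb hab
    · have : G b = 0 := by rw [hG, Set.indicator_of_notMem (by simpa using hbl)]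
      rw [this]
      exact hGnn a ha
  have hGi : IntegrableOn G (Set.Ioi 0) := hint.indicator measurableSet_Iic
  set f : ℝ → ℝ := fun t => G (c + Δ * t) with hf
  have hfa : AntitoneOn f (Set.Ici 0) := by
    intro a ha b hb hab
    have ha' : (0 : ℝ) ≤ a := ha
    have hb' : (0 : ℝ) ≤ b := hb
    refine hGa ?_ ?_ ?_
    · simp only [Set.mem_Ici]; positivity
    · simp only [Set.mem_Ici]; positivity
    · gcongr
  have hintc : IntegrableOn G (Set.Ioi c) := hGi.mono_set (Set.Ioi_subset_Ioi hpos.le)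
  have hfi : IntegrableOn f (Set.Ioi 0) := integrableOn_Ioi_affine hintc hΔ
  have hfn : ∀ t ∈ Set.Ioi (0 : ℝ), 0 ≤ f t := by
    intro t ht
    have ht' : (0 : ℝ) < t := ht
    exact hGnn _ (by positivity)
  have hsm := hfa.summable_of_integrableOn_Ioi_zero hfi hfn
  have h1 := hfa.integral_le_tsum hsm hfn
  have h2 : ∑' n : ℕ, f n ≤ ∑ k ∈ F, g (s0 + k * Δ) := by
    refine Real.tsum_le_of_sum_range_le (fun n => hGnn _ (by positivity)) fun n => ?_
    have e1 : ∑ i ∈ Finset.range n, f i =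
        ∑ k ∈ (Finset.range n).image (fun i => i + k0), G (s0 + k * Δ) := by
      rw [Finset.sum_image (by intro a _ b _ hab; simpa using hab)]
      refine Finset.sum_congr rfl fun i _ => ?_
      rw [hf, hc]
      simp only
      congr 1
      push_cast; ring
    have e2 : ∀ k : ℕ, G (s0 + k * Δ) = if s0 + k * Δ ≤ ℓ then g (s0 + k * Δ) else 0 := by
      intro k
      rw [hG, Set.indicator_apply]
      simp
    rw [e1]
    simp_rw [e2]
    rw [← Finset.sum_filter]
    refine Finset.sum_le_sum_of_subset_of_nonneg ?_ fun k hk _ => hnn _ (hF0 k hk).le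
    intro k hk
    simp only [Finset.mem_filter, Finset.mem_image] at hk
    obtain ⟨⟨i, -, rfl⟩, hle⟩ := hk
    refine hF _ ?_ hle
    push_cast
    have : (0 : ℝ) ≤ i * Δ := by positivity
    rw [hc] at hpos
    nlinarith
  have h4 : Δ * ∫ t in Set.Ioi 0, f t = ∫ t in Set.Ioi c, G t := by
    rw [hf, setIntegral_Ioi_affine G c hΔ]
  have h5 : ∫ t in Set.Ioi 0, G t = (∫ t in Set.Ioc 0 c, G t) + ∫ t in Set.Ioi c, G t := by
    rw [← setIntegral_union (Set.Ioc_disjoint_Ioi le_rfl) measurableSet_Ioi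
      (hGi.mono_set Set.Ioc_subset_Ioi_self) hintc, Set.Ioc_union_Ioi_eq_Ioi hpos.le]
  have h6 : ∫ t in Set.Ioc 0 c, G t ≤ Δ * g 0 := by
    have hb : ∫ t in Set.Ioc 0 c, G t ≤ ∫ t in Set.Ioc 0 c, g 0 := by
      refine setIntegral_mono_on (hGi.mono_set Set.Ioc_subset_Ioi_self) (by simp)
        measurableSet_Ioc fun t ht => ?_
      exact (hGg t ht.1.le).trans (hanti (by simp) ht.1.le ht.1.le)
    refine hb.trans ?_
    simp only [setIntegral_const, smul_eq_mul, Real.volume_real_Ioc_of_le hpos.le, sub_zero]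
    exact mul_le_mul_of_nonneg_right hle (hnn 0 le_rfl)
  have h7 : ∫ t in Set.Ioi 0, g t = (∫ t in Set.Ioi 0, G t) + ∫ t in Set.Ioi ℓ, g t := by
    rw [hG, setIntegral_indicator measurableSet_Iic, Set.Ioi_inter_Iic,
      ← setIntegral_union (Set.Ioc_disjoint_Ioi le_rfl) measurableSet_Ioi
      (hint.mono_set Set.Ioc_subset_Ioi_self) (hint.mono_set (Set.Ioi_subset_Ioi hℓ)),
      Set.Ioc_union_Ioi_eq_Ioi hℓ]
  have h8 := mul_le_mul_of_nonneg_left (h1.trans h2) hΔ.le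
  linarith

/-- The Laplace transform at `x` of the Gaussian `exp (-b s²)` restricted to `s > 0`;
for `b = 1/2` this is the Mills ratio of the standard normal law. -/
def gaussLaplace (b x : ℝ) : ℝ := ∫ s in Set.Ioi 0, Real.exp (-(x * s) - b * s ^ 2)

lemma integrableOn_gaussLaplace {b x : ℝ} (hb : 0 < b) (hx : 0 ≤ x) :
    IntegrableOn (fun s : ℝ => Real.exp (-(x * s) - b * s ^ 2)) (Set.Ioi 0) := by
  refine Integrable.mono' (integrable_exp_neg_mul_sq hb).integrableOn (by fun_prop) ?_
  filter_upwards [ae_restrict_mem measurableSet_Ioi] with s hs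
  have hs' : (0 : ℝ) < s := hs
  rw [Real.norm_eq_abs, Real.abs_exp]
  apply Real.exp_le_exp.2
  have : 0 ≤ x * s := by positivity
  linarith

lemma antitoneOn_gaussLaplace {b x : ℝ} (hb : 0 < b) (hx : 0 ≤ x) :
    AntitoneOn (fun s : ℝ => Real.exp (-(x * s) - b * s ^ 2)) (Set.Ici 0) := by
  intro s hs t _ hst
  have hs' : (0 : ℝ) ≤ s := hs
  apply Real.exp_le_exp.2
  have h1 : x * s ≤ x * t := by gcongr
  have h2 : b * s ^ 2 ≤ b * t ^ 2 := by gcongr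
  linarith

lemma gaussLaplace_eighth_le {x : ℝ} (hx : 0 ≤ x) :
    gaussLaplace (1 / 8) x ≤ 2 * gaussLaplace (1 / 2) x := by
  have h := setIntegral_Ioi_affine (fun s : ℝ => Real.exp (-(x * s) - 1 / 8 * s ^ 2)) 0
    (Δ := 2) two_pos
  unfold gaussLaplace
  rw [← h]
  refine mul_le_mul_of_nonneg_left ?_ (by norm_num)
  refine setIntegral_mono_on
    (integrableOn_Ioi_affine (integrableOn_gaussLaplace (by norm_num) hx) two_pos)
    (integrableOn_gaussLaplace (by norm_num) hx) measurableSet_Ioi fun s hs => ?_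
  have hs' : (0 : ℝ) < s := hs
  apply Real.exp_le_exp.2
  have : 0 ≤ x * s := by positivity
  nlinarith

lemma le_gaussLaplace_half {x : ℝ} (hx : 0 ≤ x) :
    Real.exp (-(3 / 2)) / (1 + x) ≤ gaussLaplace (1 / 2) x := by
  have hi := integrableOn_gaussLaplace (b := 1 / 2) (by norm_num) hx
  have hx1 : 0 < 1 + x := by linarith
  have hpos : 0 ≤ 1 / (1 + x) := by positivity
  calc Real.exp (-(3 / 2)) / (1 + x)
      = ∫ _ in Set.Ioc 0 (1 / (1 + x)), Real.exp (-(3 / 2)) := by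
        simp only [setIntegral_const, smul_eq_mul, Real.volume_real_Ioc_of_le hpos]
        ring
    _ ≤ ∫ s in Set.Ioc 0 (1 / (1 + x)), Real.exp (-(x * s) - 1 / 2 * s ^ 2) := by
        refine setIntegral_mono_on (by simp) (hi.mono_set Set.Ioc_subset_Ioi_self)
          measurableSet_Ioc fun s hs => ?_
        apply Real.exp_le_exp.2
        have h1 : s * (1 + x) ≤ 1 := (le_div_iff₀ hx1).1 hs.2
        have h2 : 0 ≤ x * s := mul_nonneg hx hs.1.le
        have h3 : s ≤ 1 := by nlinarith
        have h4 : s ^ 2 ≤ 1 := by nlinarith [hs.1]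
        nlinarith [hs.1]
    _ ≤ _ := by
        refine setIntegral_mono_set hi ?_ Set.Ioc_subset_Ioi_self.eventuallyLE
        exact ae_of_all _ fun s => (Real.exp_pos _).le

lemma gaussLaplace_half_pos {x : ℝ} (hx : 0 ≤ x) : 0 < gaussLaplace (1 / 2) x :=
  lt_of_lt_of_le (by positivity) (le_gaussLaplace_half hx)

lemma gaussLaplace_half_tail_le {x ℓ : ℝ} (hx : 0 ≤ x) (hℓ : 0 ≤ ℓ) :
    ∫ s in Set.Ioi ℓ, Real.exp (-(x * s) - 1 / 2 * s ^ 2) ≤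
      Real.exp (-(3 / 8 * ℓ ^ 2)) * (2 * gaussLaplace (1 / 2) x) := by
  have hi2 := integrableOn_gaussLaplace (b := 1 / 2) (by norm_num) hx
  have hi8 := integrableOn_gaussLaplace (b := 1 / 8) (by norm_num) hx
  have hsub : Set.Ioi ℓ ⊆ Set.Ioi (0 : ℝ) := Set.Ioi_subset_Ioi hℓ
  calc _ ≤ ∫ s in Set.Ioi ℓ, Real.exp (-(3 / 8 * ℓ ^ 2)) *
        Real.exp (-(x * s) - 1 / 8 * s ^ 2) := by
        refine setIntegral_mono_on (hi2.mono_set hsub) ((hi8.mono_set hsub).const_mul _)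
          measurableSet_Ioi fun s hs => ?_
        have hs' : ℓ < s := hs
        rw [← Real.exp_add]
        apply Real.exp_le_exp.2
        nlinarith
    _ = Real.exp (-(3 / 8 * ℓ ^ 2)) *
        ∫ s in Set.Ioi ℓ, Real.exp (-(x * s) - 1 / 8 * s ^ 2) := by
        rw [integral_const_mul]
    _ ≤ _ := by
        refine mul_le_mul_of_nonneg_left ?_ (Real.exp_pos _).le
        refine le_trans ?_ (gaussLaplace_eighth_le hx)
        refine setIntegral_mono_set hi8 ?_ hsub.eventuallyLE
        exact ae_of_all _ fun s => (Real.exp_pos _).le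

lemma abs_exp_sub_one_le_mul_exp (θ : ℝ) : |Real.exp θ - 1| ≤ |θ| * Real.exp |θ| := by
  have h1 := Real.add_one_le_exp θ
  have h2 := Real.add_one_le_exp (-θ)
  have h3 : Real.exp (-θ) * Real.exp θ = 1 := by rw [← Real.exp_add]; simp
  have h4 : 1 ≤ Real.exp |θ| := Real.one_le_exp (abs_nonneg θ)
  have h5 : |θ| ≤ |θ| * Real.exp |θ| := le_mul_of_one_le_right (abs_nonneg θ) h4
  rw [abs_le]
  constructor
  · linarith [neg_abs_le θ]
  · have h6 : Real.exp θ - 1 ≤ θ * Real.exp θ := by nlinarith [Real.exp_pos θ]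
    refine h6.trans ?_
    calc θ * Real.exp θ ≤ |θ| * Real.exp θ := by gcongr; exact le_abs_self θ
      _ ≤ _ := by gcongr; exact le_abs_self θ

lemma one_add_cube_le_exp (s : ℝ) : 1 + s ^ 3 ≤ 16 * Real.exp (1 / 4 * s ^ 2) := by
  have h := Real.quadratic_le_exp_of_nonneg (show 0 ≤ 1 / 4 * s ^ 2 by positivity)
  nlinarith [sq_nonneg (s * (s - 1)), sq_nonneg s, sq_nonneg (s ^ 2)]

/-- Comparison of a perturbed Gaussian weight at `x + s` with the Gaussian weight. -/
lemma abs_perturbed_gauss_sub_le {x s ν K δ θ : ℝ} (hx : 0 ≤ x) (hs : 0 ≤ s) (hν : 1 ≤ ν)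
    (hK : 0 ≤ K) (hsν : s ≤ δ * ν) (hxν : x ^ 3 ≤ ν) (hKδ : 32 * K * δ ≤ 1)
    (hθ : |θ| ≤ K * (1 + (x + s) ^ 3) / ν) :
    |Real.exp (-(x + s) ^ 2 / 2 + θ) -
      Real.exp (-x ^ 2 / 2) * Real.exp (-(x * s) - 1 / 2 * s ^ 2)| ≤
      Real.exp (-x ^ 2 / 2) * (64 * K * Real.exp (5 * K) * ((1 + x ^ 3) / ν)) *
        Real.exp (-(x * s) - 1 / 8 * s ^ 2) := by
  have hν0 : 0 < ν := by linarith
  have hcube : (x + s) ^ 3 ≤ 4 * (x ^ 3 + s ^ 3) := by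
    nlinarith [mul_nonneg (add_nonneg hx hs) (sq_nonneg (x - s))]
  have hx3 : 0 ≤ x ^ 3 := by positivity
  have hs3 : 0 ≤ s ^ 3 := by positivity
  have hθ1 : |θ| ≤ 5 * K + 1 / 8 * s ^ 2 := by
    refine hθ.trans ?_
    rw [div_le_iff₀ hν0]
    have h1 : K * (1 + (x + s) ^ 3) ≤ K * (1 + 4 * (x ^ 3 + s ^ 3)) := by gcongr
    have h2 : K * s ^ 3 ≤ K * (s ^ 2 * (δ * ν)) := by
      have : s ^ 3 = s ^ 2 * s := by ring
      rw [this]; gcongr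
    have h3 : (32 * K * δ) * (s ^ 2 * ν) ≤ 1 * (s ^ 2 * ν) := by gcongr
    have h4 : K * x ^ 3 ≤ K * ν := by gcongr
    have h5 : K * 1 ≤ K * ν := by gcongr
    nlinarith
  have hθ2 : |θ| ≤ 64 * K * ((1 + x ^ 3) / ν) * Real.exp (1 / 4 * s ^ 2) := by
    refine hθ.trans ?_
    have h1 : 1 + (x + s) ^ 3 ≤ 4 * ((1 + x ^ 3) * (1 + s ^ 3)) := by nlinarith
    have h2 : (1 + x ^ 3) * (1 + s ^ 3) ≤ (1 + x ^ 3) * (16 * Real.exp (1 / 4 * s ^ 2)) := by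
      gcongr; exact one_add_cube_le_exp s
    calc K * (1 + (x + s) ^ 3) / ν
        ≤ K * (4 * ((1 + x ^ 3) * (16 * Real.exp (1 / 4 * s ^ 2)))) / ν := by
          gcongr; linarith
      _ = _ := by ring
  have e1 : Real.exp (-(x + s) ^ 2 / 2 + θ) =
      Real.exp (-x ^ 2 / 2) * Real.exp (-(x * s) - 1 / 2 * s ^ 2) * Real.exp θ := by
    rw [← Real.exp_add, ← Real.exp_add]; congr 1; ring
  have e2 : ∀ A : ℝ, A * Real.exp θ - A = A * (Real.exp θ - 1) := fun A => by ring
  rw [e1, e2, abs_mul, abs_of_pos (by positivity)]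
  have hfin : |Real.exp θ - 1| ≤ 64 * K * ((1 + x ^ 3) / ν) * Real.exp (1 / 4 * s ^ 2) *
      Real.exp (5 * K + 1 / 8 * s ^ 2) := by
    refine (abs_exp_sub_one_le_mul_exp θ).trans ?_
    gcongr
  refine (mul_le_mul_of_nonneg_left hfin (by positivity)).trans (le_of_eq ?_)
  have e3 : Real.exp (-(x * s) - 1 / 8 * s ^ 2) = Real.exp (-(x * s) - 1 / 2 * s ^ 2) *
      Real.exp (1 / 4 * s ^ 2) * Real.exp (1 / 8 * s ^ 2) := by
    rw [← Real.exp_add, ← Real.exp_add]; congr 1; ring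
  rw [e3, Real.exp_add]; ring

lemma exp_neg_le_inv {z : ℝ} (hz : 0 < z) : Real.exp (-z) ≤ 1 / z := by
  rw [Real.exp_neg, ← one_div]
  exact one_div_le_one_div_of_le hz (by linarith [Real.add_one_le_exp z])

lemma exp_neg_sq_sub_two_le {x : ℝ} (hx : 0 ≤ x) :
    Real.exp (-x ^ 2 - 2) ≤ Real.exp (-x ^ 2 / 2) * gaussLaplace (1 / 2) x := by
  have h1 := le_gaussLaplace_half hx
  have h2 : Real.exp (-(x ^ 2 / 2) - 2) ≤ Real.exp (-(3 / 2)) / (1 + x) := by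
    rw [le_div_iff₀ (by linarith)]
    have : 1 + x ≤ Real.exp x := by linarith [Real.add_one_le_exp x]
    calc _ ≤ Real.exp (-(x ^ 2 / 2) - 2) * Real.exp x := by gcongr
      _ = Real.exp (-(x ^ 2 / 2) - 2 + x) := by rw [Real.exp_add]
      _ ≤ _ := by apply Real.exp_le_exp.2; nlinarith [sq_nonneg (x - 1)]
  calc Real.exp (-x ^ 2 - 2) = Real.exp (-x ^ 2 / 2) * Real.exp (-(x ^ 2 / 2) - 2) := by
        rw [← Real.exp_add]; congr 1; ring
    _ ≤ _ := by gcongr; exact h2.trans h1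

lemma abs_lattice_gauss_sub_le {x s0 Δ ℓ : ℝ} (hx : 0 ≤ x) (hΔ : 0 < Δ) (hs0 : s0 ≤ 0)
    (hℓ : 0 ≤ ℓ) (F : Finset ℕ) (hF0 : ∀ k ∈ F, 0 < s0 + k * Δ)
    (hF : ∀ k : ℕ, 0 < s0 + k * Δ → s0 + k * Δ ≤ ℓ → k ∈ F) :
    |Δ * ∑ k ∈ F, Real.exp (-(x * (s0 + k * Δ)) - 1 / 2 * (s0 + k * Δ) ^ 2) -
      gaussLaplace (1 / 2) x| ≤
      Δ + Real.exp (-(3 / 8 * ℓ ^ 2)) * (2 * gaussLaplace (1 / 2) x) := by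
  have hanti := antitoneOn_gaussLaplace (b := 1 / 2) (by norm_num) hx
  have hint := integrableOn_gaussLaplace (b := 1 / 2) (by norm_num) hx
  have hnn : ∀ t : ℝ, 0 ≤ t → 0 ≤ Real.exp (-(x * t) - 1 / 2 * t ^ 2) :=
    fun t _ => (Real.exp_pos _).le
  have h1 := lattice_sum_le hanti hint hnn hΔ hs0 F hF0
  have h2 := le_lattice_sum hanti hint hnn hΔ hs0 hℓ F hF0 hF
  have h3 := gaussLaplace_half_tail_le hx hℓ
  have hR := gaussLaplace_half_pos hx
  have h4 : 0 ≤ Real.exp (-(3 / 8 * ℓ ^ 2)) * (2 * gaussLaplace (1 / 2) x) := by positivity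
  simp only [mul_zero, neg_zero, ne_eq, OfNat.ofNat_ne_zero, not_false_eq_true, zero_pow,
    sub_self, Real.exp_zero, mul_one] at h1 h2
  rw [abs_le]
  unfold gaussLaplace at *
  constructor <;> linarith

lemma lattice_gauss_eighth_le {x s0 Δ : ℝ} (hx : 0 ≤ x) (hΔ : 0 < Δ) (hs0 : s0 ≤ 0)
    (F : Finset ℕ) (hF0 : ∀ k ∈ F, 0 < s0 + k * Δ) :
    Δ * ∑ k ∈ F, Real.exp (-(x * (s0 + k * Δ)) - 1 / 8 * (s0 + k * Δ) ^ 2) ≤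
      Δ + 2 * gaussLaplace (1 / 2) x := by
  have h1 := lattice_sum_le (antitoneOn_gaussLaplace (b := 1 / 8) (by norm_num) hx)
    (integrableOn_gaussLaplace (b := 1 / 8) (by norm_num) hx)
    (fun t _ => (Real.exp_pos _).le) hΔ hs0 F hF0
  have h2 := gaussLaplace_eighth_le hx
  simp only [mul_zero, neg_zero, ne_eq, OfNat.ofNat_ne_zero, not_false_eq_true, zero_pow,
    sub_self, Real.exp_zero, mul_one] at h1
  unfold gaussLaplace at *
  linarith

/-- A mesh of order `1/ν` is small relative to the Mills ratio. -/
lemma mesh_le_gaussLaplace {x ν Δ D : ℝ} (hx : 0 ≤ x) (hν : 1 ≤ ν) (hD : 0 < D)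
    (hΔ : Δ ≤ D / ν) (hxν : x ^ 3 ≤ ν) :
    Δ ≤ 2 * D * Real.exp (3 / 2) * ((1 + x ^ 3) / ν) * gaussLaplace (1 / 2) x ∧
    Δ ≤ 2 * D * Real.exp (3 / 2) * gaussLaplace (1 / 2) x := by
  have hR := le_gaussLaplace_half hx
  have hx1 : 0 < 1 + x := by linarith
  have hx3 := le_one_add_cube hx
  have hν0 : 0 < ν := by linarith
  rw [div_le_iff₀ hx1] at hR
  have hRp := gaussLaplace_half_pos hx
  have hee : Real.exp (3 / 2) * Real.exp (-(3 / 2)) = 1 := by rw [← Real.exp_add]; simp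
  have h1 : 1 ≤ Real.exp (3 / 2) * (gaussLaplace (1 / 2) x * (1 + x)) := by
    calc 1 = Real.exp (3 / 2) * Real.exp (-(3 / 2)) := hee.symm
      _ ≤ _ := by gcongr
  have hx30 : 0 ≤ x ^ 3 := by positivity
  have h2 : 1 ≤ Real.exp (3 / 2) * (gaussLaplace (1 / 2) x * (2 * (1 + x ^ 3))) :=
    h1.trans (by gcongr; linarith)
  have hxν' : x ≤ ν := by
    by_contra hc
    push Not at hc
    nlinarith [mul_pos hν0 hν0, sq_nonneg x]
  have h3 : 1 ≤ Real.exp (3 / 2) * (gaussLaplace (1 / 2) x * (2 * ν)) :=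
    h1.trans (by gcongr; linarith)
  constructor
  · refine hΔ.trans ?_
    calc D / ν = D / ν * 1 := by ring
      _ ≤ D / ν * (Real.exp (3 / 2) * (gaussLaplace (1 / 2) x * (2 * (1 + x ^ 3)))) := by gcongr
      _ = _ := by ring
  · refine hΔ.trans ?_
    calc D / ν = D / ν * 1 := by ring
      _ ≤ D / ν * (Real.exp (3 / 2) * (gaussLaplace (1 / 2) x * (2 * ν))) := by gcongr
      _ = _ := by field_simp

lemma far_mass_le {x ν c : ℝ} (hx : 0 ≤ x) (hν : 1 ≤ ν) (hc : 0 < c)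
    (hxc : x ^ 2 ≤ c / 2 * ν ^ 2) :
    Real.exp (-c * ν ^ 2) ≤ Real.exp 2 * (2 / c) * ((1 + x ^ 3) / ν) *
      (Real.exp (-x ^ 2 / 2) * gaussLaplace (1 / 2) x) := by
  have h1 := exp_neg_sq_sub_two_le hx
  have h2 : Real.exp (-(c / 2 * ν ^ 2)) ≤ 2 / c * ((1 + x ^ 3) / ν) := by
    refine (exp_neg_le_inv (by positivity)).trans ?_
    have : 1 / (c / 2 * ν ^ 2) = 2 / c * (1 / ν ^ 2) := by field_simp
    rw [this]
    have h3 : 1 / ν ^ 2 ≤ 1 / ν :=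
      one_div_le_one_div_of_le (by linarith) (by nlinarith)
    have h4 : 1 / ν ≤ (1 + x ^ 3) / ν := by
      gcongr
      have : 0 ≤ x ^ 3 := by positivity
      linarith
    exact mul_le_mul_of_nonneg_left (h3.trans h4) (by positivity)
  calc Real.exp (-c * ν ^ 2)
      ≤ Real.exp (2 + -(c / 2 * ν ^ 2) + (-x ^ 2 - 2)) := by
        apply Real.exp_le_exp.2; linarith
    _ = Real.exp 2 * Real.exp (-(c / 2 * ν ^ 2)) * Real.exp (-x ^ 2 - 2) := by
        rw [Real.exp_add, Real.exp_add]
    _ ≤ Real.exp 2 * (2 / c * ((1 + x ^ 3) / ν)) *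
        (Real.exp (-x ^ 2 / 2) * gaussLaplace (1 / 2) x) := by gcongr
    _ = _ := by ring

lemma gauss_tail_factor_le {x ν δ ℓ : ℝ} (hx : 0 ≤ x) (hν : 1 ≤ ν) (hδ : 0 < δ)
    (hℓ : δ / 2 * ν ≤ ℓ) :
    Real.exp (-(3 / 8 * ℓ ^ 2)) ≤ 11 / δ ^ 2 * ((1 + x ^ 3) / ν) := by
  have hℓ0 : 0 < δ / 2 * ν := by positivity
  have h0 : (δ / 2 * ν) ^ 2 ≤ ℓ ^ 2 := by gcongr
  have h1 : 1 / ν ^ 2 ≤ (1 + x ^ 3) / ν := by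
    have h3 : 1 / ν ^ 2 ≤ 1 / ν :=
      one_div_le_one_div_of_le (by linarith) (by nlinarith)
    refine h3.trans ?_
    gcongr
    have : 0 ≤ x ^ 3 := by positivity
    linarith
  calc Real.exp (-(3 / 8 * ℓ ^ 2)) ≤ Real.exp (-(3 / 8 * (δ / 2 * ν) ^ 2)) := by
        apply Real.exp_le_exp.2; linarith
    _ ≤ 1 / (3 / 8 * (δ / 2 * ν) ^ 2) := exp_neg_le_inv (by positivity)
    _ = 32 / 3 / δ ^ 2 * (1 / ν ^ 2) := by field_simp; norm_num
    _ ≤ 11 / δ ^ 2 * ((1 + x ^ 3) / ν) := by gcongr; norm_num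

/-- Upper tails of an array of weights that are approximately Gaussian on a lattice
of mesh `Δ ≤ D / ν`. -/
theorem lattice_tail {δ K K' c D : ℝ} (hδ : 0 < δ) (hK : 0 < K) (hK' : 0 < K') (hc : 0 < c)
    (hD : 0 < D) (hKδ : 32 * K * δ ≤ 1) :
    ∃ C > 0, ∃ L > 0, ∀ (ν Δ y0 : ℝ) (M : ℕ) (W : ℕ → ℝ), 1 ≤ ν → 0 < Δ → Δ ≤ D / ν →
      y0 ≤ 0 → δ * ν ≤ y0 + M * Δ → (∀ k, 0 ≤ W k) →
      (∀ k ≤ M, 0 < y0 + k * Δ → y0 + k * Δ ≤ δ * ν →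
        ∃ θ, W k = Real.exp (-(y0 + k * Δ) ^ 2 / 2 + θ) ∧
          |θ| ≤ K * (1 + (y0 + k * Δ) ^ 3) / ν) →
      Δ * ∑ k ∈ (Finset.range (M + 1)).filter (fun k : ℕ => δ * ν < y0 + k * Δ), W k ≤
        K' * Real.exp (-c * ν ^ 2) →
      ∀ x, 0 ≤ x → x ≤ C * ν → x ^ 3 ≤ ν →
        |Δ * ∑ k ∈ (Finset.range (M + 1)).filter (fun k : ℕ => x < y0 + k * Δ), W k -
          Real.exp (-x ^ 2 / 2) * gaussLaplace (1 / 2) x| ≤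
        L * ((1 + x ^ 3) / ν) * (Real.exp (-x ^ 2 / 2) * gaussLaplace (1 / 2) x) := by
  refine ⟨min (δ / 2) (Real.sqrt (c / 2)), by positivity,
    64 * K * Real.exp (5 * K) * (2 * D * Real.exp (3 / 2) + 2) +
      (2 * D * Real.exp (3 / 2) + 11 / δ ^ 2 * 2) + K' * (Real.exp 2 * (2 / c)), by positivity, ?_⟩
  intro ν Δ y0 M W hν hΔ hΔD hy0 hM hW hnear hfar x hx hxC hx3
  have hν0 : 0 < ν := by linarith
  have hxδ : x ≤ δ / 2 * ν := hxC.trans (by gcongr; exact min_le_left _ _)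
  have hxc : x ^ 2 ≤ c / 2 * ν ^ 2 := by
    have : x ≤ Real.sqrt (c / 2) * ν := hxC.trans (by gcongr; exact min_le_right _ _)
    calc x ^ 2 ≤ (Real.sqrt (c / 2) * ν) ^ 2 := by gcongr
      _ = _ := by rw [mul_pow, Real.sq_sqrt (by positivity)]
  set F := (Finset.range (M + 1)).filter (fun k : ℕ => x < y0 + k * Δ ∧ y0 + k * Δ ≤ δ * ν)
    with hFdef
  have hsplit : ∑ k ∈ (Finset.range (M + 1)).filter (fun k : ℕ => x < y0 + k * Δ), W k =
      ∑ k ∈ F, W k +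
        ∑ k ∈ (Finset.range (M + 1)).filter (fun k : ℕ => δ * ν < y0 + k * Δ), W k := by
    rw [← Finset.sum_filter_add_sum_filter_not _ (fun k : ℕ => y0 + k * Δ ≤ δ * ν),
      Finset.filter_filter, Finset.filter_filter]
    congr 1
    refine Finset.sum_congr (Finset.filter_congr fun k _ => ?_) fun _ _ => rfl
    rw [not_le]
    exact ⟨fun h => h.2, fun h => ⟨by nlinarith, h⟩⟩
  have hFpos : ∀ k ∈ F, 0 < (y0 - x) + k * Δ := fun k hk => by
    have := (Finset.mem_filter.1 hk).2.1
    linarith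
  have hFmem : ∀ k : ℕ, 0 < (y0 - x) + k * Δ → (y0 - x) + k * Δ ≤ δ * ν - x → k ∈ F := by
    intro k h1 h2
    refine Finset.mem_filter.2 ⟨?_, by linarith, by linarith⟩
    rw [Finset.mem_range]
    have : (k : ℝ) ≤ M := by
      by_contra hcon
      push Not at hcon
      have := mul_lt_mul_of_pos_right hcon hΔ
      linarith
    have : k ≤ M := by exact_mod_cast this
    omega
  have hs0 : y0 - x ≤ 0 := by linarith
  have hB := abs_lattice_gauss_sub_le hx hΔ hs0 (ℓ := δ * ν - x) (by nlinarith) F hFpos hFmem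
  have hT := gauss_tail_factor_le (x := x) (ℓ := δ * ν - x) hx hν hδ (by linarith)
  have hE := lattice_gauss_eighth_le hx hΔ hs0 F hFpos
  obtain ⟨hm1, hm2⟩ := mesh_le_gaussLaplace hx hν hD hΔD hx3
  have hfm := far_mass_le hx hν hc hxc
  have hR := gaussLaplace_half_pos hx
  have hcmp : |Δ * ∑ k ∈ F, W k - Real.exp (-x ^ 2 / 2) * (Δ * ∑ k ∈ F,
      Real.exp (-(x * ((y0 - x) + k * Δ)) - 1 / 2 * ((y0 - x) + k * Δ) ^ 2))| ≤
      Real.exp (-x ^ 2 / 2) * (64 * K * Real.exp (5 * K) * ((1 + x ^ 3) / ν)) *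
      (Δ * ∑ k ∈ F, Real.exp (-(x * ((y0 - x) + k * Δ)) - 1 / 8 * ((y0 - x) + k * Δ) ^ 2)) := by
    have e1 : ∀ A B : ℝ, Δ * A - Real.exp (-x ^ 2 / 2) * (Δ * B) =
      Δ * (A - Real.exp (-x ^ 2 / 2) * B) := fun A B => by ring
    rw [e1, Finset.mul_sum, ← Finset.sum_sub_distrib, abs_mul, abs_of_pos hΔ, mul_left_comm,
      Finset.mul_sum (a := Real.exp (-x ^ 2 / 2) * _)]
    refine mul_le_mul_of_nonneg_left ?_ hΔ.le
    refine (Finset.abs_sum_le_sum_abs _ _).trans (Finset.sum_le_sum fun k hk => ?_)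
    obtain ⟨hkM, hk1, hk2⟩ := Finset.mem_filter.1 hk
    obtain ⟨θ, hWk, hθ⟩ := hnear k (by rw [Finset.mem_range] at hkM; omega) (by linarith) hk2
    have e2 : x + ((y0 - x) + k * Δ) = y0 + k * Δ := by ring
    have := abs_perturbed_gauss_sub_le (θ := θ) hx (hFpos k hk).le hν hK.le (by linarith) hx3 hKδ
      (by rw [e2]; exact hθ)
    rw [e2] at this
    rw [hWk]
    exact this
  rw [hsplit, mul_add]
  set E := Real.exp (-x ^ 2 / 2) with hEdef
  set R := gaussLaplace (1 / 2) x with hRdef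
  set t := (1 + x ^ 3) / ν with htdef
  have ht : 0 < t := by positivity
  have hEpos : 0 < E := Real.exp_pos _
  set S := Δ * ∑ k ∈ F, W k
  set G := Δ * ∑ k ∈ F, Real.exp (-(x * ((y0 - x) + k * Δ)) - 1 / 2 * ((y0 - x) + k * Δ) ^ 2)
  set Q := Δ * ∑ k ∈ (Finset.range (M + 1)).filter (fun k : ℕ => δ * ν < y0 + k * Δ), W k with hQ
  have hQ0 : 0 ≤ Q := mul_nonneg hΔ.le (Finset.sum_nonneg fun k _ => hW k)
  have b1 : |S - E * G| ≤ E * (64 * K * Real.exp (5 * K) * t) *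
      (2 * D * Real.exp (3 / 2) * R + 2 * R) :=
    hcmp.trans (mul_le_mul_of_nonneg_left (hE.trans (by linarith)) (by positivity))
  have b2 : |E * G - E * R| ≤ E * (2 * D * Real.exp (3 / 2) * t * R + 11 / δ ^ 2 * t * (2 * R)) := by
    rw [← mul_sub, abs_mul, abs_of_pos hEpos]
    refine mul_le_mul_of_nonneg_left (hB.trans (add_le_add hm1 ?_)) hEpos.le
    exact mul_le_mul_of_nonneg_right hT (by positivity)
  have b3 : |Q| ≤ K' * (Real.exp 2 * (2 / c) * t * (E * R)) := by
    rw [abs_of_nonneg hQ0]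
    exact hfar.trans (by gcongr)
  calc |S + Q - E * R| = |(S - E * G) + (E * G - E * R) + Q| := by congr 1; ring
    _ ≤ |S - E * G| + |E * G - E * R| + |Q| := abs_add_three _ _ _
    _ ≤ _ := add_le_add (add_le_add b1 b2) b3
    _ = _ := by ring

lemma setIntegral_Ioi_gauss (x : ℝ) :
    ∫ t in Set.Ioi x, Real.exp (-t ^ 2 / 2) =
      Real.exp (-x ^ 2 / 2) * gaussLaplace (1 / 2) x := by
  rw [← setIntegral_Ioi_shift, gaussLaplace, ← integral_const_mul]
  congr 1 with s
  rw [← Real.exp_add]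
  congr 1
  ring

lemma integrable_gauss : Integrable fun t : ℝ => Real.exp (-t ^ 2 / 2) := by
  have := integrable_exp_neg_mul_sq (b := 1 / 2) (by norm_num)
  refine this.congr (ae_of_all _ fun t => ?_)
  simp only
  congr 1
  ring

lemma integral_gauss : ∫ t : ℝ, Real.exp (-t ^ 2 / 2) = Real.sqrt (2 * Real.pi) := by
  have := integral_gaussian (1 / 2)
  rw [show Real.pi / (1 / 2) = 2 * Real.pi by ring] at this
  rw [← this]
  congr 1 with t
  congr 1
  ring

lemma one_sub_stdNormCDF (x : ℝ) :
    1 - stdNormCDF x =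
      Real.exp (-x ^ 2 / 2) * gaussLaplace (1 / 2) x / Real.sqrt (2 * Real.pi) := by
  have hs : 0 < Real.sqrt (2 * Real.pi) := by positivity
  have h1 := intervalIntegral.integral_Iic_add_Ioi (b := x)
    integrable_gauss.integrableOn integrable_gauss.integrableOn
  rw [integral_gauss, setIntegral_Ioi_gauss] at h1
  have h2 : stdNormCDF x =
      (Real.sqrt (2 * Real.pi))⁻¹ * ∫ t in Set.Iic x, Real.exp (-t ^ 2 / 2) := by
    simp only [stdNormCDF, gaussCDF, gaussProb, mul_one]
    rw [integral_const_mul]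
  rw [h2, eq_div_iff hs.ne', sub_mul, one_mul, mul_right_comm, inv_mul_cancel₀ hs.ne', one_mul]
  linarith

lemma two_mul_gaussLaplace_zero : 2 * gaussLaplace (1 / 2) 0 = Real.sqrt (2 * Real.pi) := by
  have h := integral_gaussian_Ioi (1 / 2)
  have h2 : gaussLaplace (1 / 2) 0 = ∫ x in Set.Ioi 0, Real.exp (-(1 / 2) * x ^ 2) := by
    unfold gaussLaplace
    congr 1 with s
    congr 1
    ring
  rw [h2, h, show Real.pi / (1 / 2) = 2 * Real.pi by ring]
  ring

/-- Tails of the rescaled magnetization weights, on the side selected by `r`. -/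
theorem exists_magWeight_tail {p : ℕ} {β h m a : ℝ} (hβ : 0 < β) (hh : 0 < h)
    (hm : isUniqueMaximizer p β h m) (ha : 0 < a)
    (ha2 : iteratedDeriv 2 (Hfun p β h) m = -a) :
    ∃ C > 0, ∃ L > 0, ∀ N : ℕ, 1 ≤ N → ∀ r ∈ ({0, 1} : Set ℕ), ∀ x : ℝ, 0 ≤ x →
      x ≤ C * Real.sqrt N → x ^ 3 ≤ Real.sqrt N →
      |2 * Real.sqrt a / Real.sqrt N *
          ∑ k ∈ (Finset.range (N + 1)).filter
            (fun k : ℕ => x < (-1 : ℝ) ^ r * ((2 * (k : ℝ) - N - N * m) / Real.sqrt (N / a))),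
            magWeight p N β h k / magConst p N β h m -
        Real.exp (-x ^ 2 / 2) * gaussLaplace (1 / 2) x| ≤
      L * ((1 + x ^ 3) / Real.sqrt N) * (Real.exp (-x ^ 2 / 2) * gaussLaplace (1 / 2) x) := by
  obtain ⟨δ', hδ', K, hK, hloc⟩ := exists_magWeight_local hm.1 ha ha2
  obtain ⟨hm1, hm2⟩ := hm.1.1
  have hu : 0 < Real.sqrt a := Real.sqrt_pos.2 ha
  obtain ⟨δ, hδ, hδ1, hδ2, hδ3, hδ4⟩ : ∃ δ > 0, δ ≤ δ' ∧ δ ≤ 1 / (32 * K) ∧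
      δ ≤ (1 - m) * Real.sqrt a ∧ δ ≤ (1 + m) * Real.sqrt a := by
    have h1 : 0 < (1 - m) * Real.sqrt a := mul_pos (by linarith) hu
    have h2 : 0 < (1 + m) * Real.sqrt a := mul_pos (by linarith) hu
    refine ⟨min (min δ' (1 / (32 * K))) (min ((1 - m) * Real.sqrt a) ((1 + m) * Real.sqrt a)),
      by positivity, ?_, ?_, ?_, ?_⟩
    · exact (min_le_left _ _).trans (min_le_left _ _)
    · exact (min_le_left _ _).trans (min_le_right _ _)
    · exact (min_le_right _ _).trans (min_le_left _ _)
    · exact (min_le_right _ _).trans (min_le_right _ _)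
  obtain ⟨K', hK', c, hc, hfar⟩ := exists_magWeight_far hβ hh hm ha hδ
  have hKδ : 32 * K * δ ≤ 1 := by
    rw [le_div_iff₀ (by positivity)] at hδ2
    linarith
  obtain ⟨C, hC, L, hL, hmain⟩ := lattice_tail (K' := 8 * Real.sqrt a * K' / c) (c := c / 2)
    (D := 2 * Real.sqrt a) hδ hK (by positivity) (by positivity) (by positivity) hKδ
  refine ⟨C, hC, L, hL, fun N hN => ?_⟩
  have hN1 : (1 : ℝ) ≤ N := by exact_mod_cast hN
  have hν1 : 1 ≤ Real.sqrt N := Real.one_le_sqrt.2 hN1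
  have hσ : Real.sqrt (N / a) = Real.sqrt N / Real.sqrt a := Real.sqrt_div (by linarith) _
  have hNν : Real.sqrt N ^ 2 = N := Real.sq_sqrt (by linarith)
  set ν := Real.sqrt N with hν
  set u := Real.sqrt a with hudef
  have hν0 : 0 < ν := by linarith
  have hA : 0 < magConst p N β h m := Real.exp_pos _
  have hside : ∀ (s z : ℝ) (e : ℕ → ℕ), |s| = 1 → (∀ j ≤ N, e j ≤ N) →
      (∀ j ≤ N, s * ((2 * (e j : ℝ) - N - N * m) / Real.sqrt (N / a)) = z + j * (2 * u / ν)) →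
      z ≤ 0 → δ * ν ≤ z + N * (2 * u / ν) → ∀ x, 0 ≤ x → x ≤ C * ν → x ^ 3 ≤ ν →
      |2 * u / ν * ∑ j ∈ (Finset.range (N + 1)).filter
          (fun j : ℕ => x < z + j * (2 * u / ν)),
          magWeight p N β h (e j) / magConst p N β h m -
        Real.exp (-x ^ 2 / 2) * gaussLaplace (1 / 2) x| ≤
      L * ((1 + x ^ 3) / ν) * (Real.exp (-x ^ 2 / 2) * gaussLaplace (1 / 2) x) := by
    intro s z e hs he hse hz hend
    have habs : ∀ j ≤ N, |(2 * (e j : ℝ) - N - N * m) / Real.sqrt (N / a)| =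
        |z + j * (2 * u / ν)| := fun j hj => by rw [← hse j hj, abs_mul, hs, one_mul]
    refine hmain ν (2 * u / ν) z N (fun j => magWeight p N β h (e j) / magConst p N β h m)
      hν1 (by positivity) le_rfl hz hend
      (fun k => div_nonneg (magWeight_nonneg _ _ _ _ _) hA.le) ?_ ?_
    · intro j hj hpos hle
      have hab : |(2 * (e j : ℝ) - N - N * m) / Real.sqrt (N / a)| = z + j * (2 * u / ν) := by
        rw [habs j hj, abs_of_pos hpos]
      obtain ⟨θ, h1, h2⟩ := hloc N hN (e j) (he j hj) _ rfl
        (by rw [hab]; exact hle.trans (by gcongr))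
      refine ⟨θ, ?_, ?_⟩
      · rw [h1, ← sq_abs, hab]
        field_simp
      · rw [hab] at h2
        exact h2
    · have hterm : ∀ j ∈ (Finset.range (N + 1)).filter
          (fun j : ℕ => δ * ν < z + j * (2 * u / ν)),
          magWeight p N β h (e j) / magConst p N β h m ≤ K' * ν * Real.exp (-c * N) := by
        intro j hj
        obtain ⟨hj1, hj2⟩ := Finset.mem_filter.1 hj
        have hjN : j ≤ N := by rw [Finset.mem_range] at hj1; omega
        rw [div_le_iff₀ hA, mul_comm]
        exact hfar N hN (e j) (he j hjN) _ rfl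
          (by rw [habs j hjN]; exact hj2.trans_le (le_abs_self _))
      have hsum := Finset.sum_le_card_nsmul _ _ _ hterm
      rw [nsmul_eq_mul] at hsum
      have hcard : ((((Finset.range (N + 1)).filter
          (fun j : ℕ => δ * ν < z + j * (2 * u / ν))).card : ℕ) : ℝ) ≤ 2 * N := by
        have h1 := Finset.card_filter_le (Finset.range (N + 1))
          (fun j : ℕ => δ * ν < z + j * (2 * u / ν))
        rw [Finset.card_range] at h1
        have h2 : (((Finset.range (N + 1)).filter
          (fun j : ℕ => δ * ν < z + j * (2 * u / ν))).card : ℝ) ≤ (N : ℝ) + 1 := by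
          exact_mod_cast h1
        linarith
      have hexp : (N : ℝ) * Real.exp (-(c / 2 * N)) ≤ 2 / c := by
        have h1 := exp_neg_le_inv (z := c / 2 * N) (by positivity)
        calc (N : ℝ) * Real.exp (-(c / 2 * N)) ≤ N * (1 / (c / 2 * N)) := by gcongr
          _ = 2 / c := by field_simp
      calc 2 * u / ν * ∑ j ∈ (Finset.range (N + 1)).filter
            (fun j : ℕ => δ * ν < z + j * (2 * u / ν)),
            magWeight p N β h (e j) / magConst p N β h m
          ≤ 2 * u / ν * (2 * N * (K' * ν * Real.exp (-c * N))) := by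
            gcongr
            exact hsum.trans (by gcongr)
        _ = 4 * u * K' * (N * Real.exp (-(c / 2 * N))) * Real.exp (-(c / 2) * ν ^ 2) := by
            have : Real.exp (-c * N) =
                Real.exp (-(c / 2 * N)) * Real.exp (-(c / 2) * ν ^ 2) := by
              rw [← Real.exp_add, hNν]; congr 1; ring
            rw [this]
            field_simp
            ring
        _ ≤ 4 * u * K' * (2 / c) * Real.exp (-(c / 2) * ν ^ 2) := by gcongr
        _ = _ := by ring
  have hNu : (N : ℝ) / Real.sqrt (N / a) = ν * u := by
    rw [hσ, div_div_eq_mul_div, div_eq_iff hν0.ne', ← hNν]; ring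
  have h2u : 2 / Real.sqrt (N / a) = 2 * u / ν := by rw [hσ, div_div_eq_mul_div]
  have hNΔ : N * (2 * u / ν) = 2 * (ν * u) := by rw [← hNu, ← h2u]; ring
  intro r hr x hx hxC hx3
  rcases hr with rfl | hr
  · have hse : ∀ k : ℕ, (-1 : ℝ) ^ 0 * ((2 * (k : ℝ) - N - N * m) / Real.sqrt (N / a)) =
        -((1 + m) * (ν * u)) + k * (2 * u / ν) := fun k => by
      rw [← hNu, ← h2u]; ring
    simp only [hse]
    refine hside 1 _ id (by simp) (fun j hj => hj) (fun j _ => ?_) ?_ ?_ x hx hxC hx3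
    · rw [← hse j]; simp
    · have := mul_pos (show 0 < 1 + m by linarith) (mul_pos hν0 hu)
      linarith
    · rw [hNΔ]
      nlinarith
  · rw [Set.mem_singleton_iff] at hr
    subst hr
    have hse : ∀ j ≤ N, (-1 : ℝ) * ((2 * ((N - j : ℕ) : ℝ) - N - N * m) / Real.sqrt (N / a)) =
        -((1 - m) * (ν * u)) + j * (2 * u / ν) := fun j hj => by
      rw [← hNu, ← h2u, Nat.cast_sub hj]; ring
    have hkey := hside (-1) (-((1 - m) * (ν * u))) (fun j => N - j) (by simp)
      (fun j _ => Nat.sub_le _ _) hse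
      (by have := mul_pos (show 0 < 1 - m by linarith) (mul_pos hν0 hu); linarith)
      (by rw [hNΔ]; nlinarith) x hx hxC hx3
    convert hkey using 4
    rw [Finset.sum_filter, Finset.sum_filter, ← Finset.sum_range_reflect]
    refine Finset.sum_congr rfl fun j hj => ?_
    have hj' : j ≤ N := by rw [Finset.mem_range] at hj; omega
    rw [show N + 1 - 1 - j = N - j by omega, pow_one, hse j hj']

/-- Gaussian asymptotics of the partition function. -/
theorem exists_magWeight_total {p : ℕ} {β h m a : ℝ} (hβ : 0 < β) (hh : 0 < h)
    (hm : isUniqueMaximizer p β h m) (ha : 0 < a)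
    (ha2 : iteratedDeriv 2 (Hfun p β h) m = -a) :
    ∃ L > 0, ∀ N : ℕ, 1 ≤ N →
      |2 * Real.sqrt a / Real.sqrt N *
          ∑ k ∈ Finset.range (N + 1), magWeight p N β h k / magConst p N β h m -
        Real.sqrt (2 * Real.pi)| ≤ L / Real.sqrt N := by
  obtain ⟨C, hC, L, hL, htail⟩ := exists_magWeight_tail hβ hh hm ha ha2
  obtain ⟨δ, hδ, K, hK, hloc⟩ := exists_magWeight_local hm.1 ha ha2
  have hR0 := gaussLaplace_half_pos (le_refl (0 : ℝ))
  have hu : 0 < Real.sqrt a := Real.sqrt_pos.2 ha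
  refine ⟨L * (2 * gaussLaplace (1 / 2) 0) + 2 * Real.sqrt a * Real.exp K, by positivity,
    fun N hN => ?_⟩
  have hN1 : (1 : ℝ) ≤ N := by exact_mod_cast hN
  have hν1 : 1 ≤ Real.sqrt N := Real.one_le_sqrt.2 hN1
  have hσ : 0 < Real.sqrt (N / a) := Real.sqrt_pos.2 (by positivity)
  have hA : 0 < magConst p N β h m := Real.exp_pos _
  have h0 := htail N hN 0 (by simp) 0 le_rfl (by positivity) (by simp)
  have h1 := htail N hN 1 (by simp) 0 le_rfl (by positivity) (by simp)
  set ν := Real.sqrt N with hν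
  have hν0 : 0 < ν := by linarith
  set Y : ℕ → ℝ := fun k => (2 * (k : ℝ) - N - N * m) / Real.sqrt (N / a) with hY
  set w : ℕ → ℝ := fun k => magWeight p N β h k / magConst p N β h m with hw
  have hw0 : ∀ k, 0 ≤ w k := fun k => div_nonneg (magWeight_nonneg _ _ _ _ _) hA.le
  have hsplit : ∑ k ∈ Finset.range (N + 1), w k =
      ∑ k ∈ (Finset.range (N + 1)).filter (fun k => 0 < Y k), w k +
      ∑ k ∈ (Finset.range (N + 1)).filter (fun k => Y k < 0), w k +
      ∑ k ∈ (Finset.range (N + 1)).filter (fun k => Y k = 0), w k := by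
    simp only [Finset.sum_filter, ← Finset.sum_add_distrib]
    refine Finset.sum_congr rfl fun k _ => ?_
    rcases lt_trichotomy (Y k) 0 with hk | hk | hk
    · simp [hk, hk.ne, hk.le]
    · simp [hk]
    · simp [hk, hk.ne', hk.le]
  have hcenter : ∑ k ∈ (Finset.range (N + 1)).filter (fun k => Y k = 0), w k ≤ Real.exp K := by
    have hterm : ∀ k ∈ (Finset.range (N + 1)).filter (fun k => Y k = 0), w k ≤ Real.exp K := by
      intro k hk
      obtain ⟨hk1, hk2⟩ := Finset.mem_filter.1 hk
      obtain ⟨θ, h2, h3⟩ := hloc N hN k (by rw [Finset.mem_range] at hk1; omega) (Y k) rfl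
        (by rw [hk2, abs_zero]; positivity)
      have hwk : w k = Real.exp θ := by
        simp only [hw, h2, hk2]
        field_simp
        simp
      rw [hwk]
      apply Real.exp_le_exp.2
      refine (le_abs_self θ).trans (h3.trans ?_)
      rw [hk2]
      simpa using div_le_self hK.le hν1
    have hcard : ((Finset.range (N + 1)).filter (fun k => Y k = 0)).card ≤ 1 := by
      refine Finset.card_le_one.2 fun i hi j hj => ?_
      have hi2 := (Finset.mem_filter.1 hi).2
      have hj2 := (Finset.mem_filter.1 hj).2
      simp only [hY, div_eq_zero_iff, hσ.ne', or_false] at hi2 hj2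
      have : (i : ℝ) = j := by linarith
      exact_mod_cast this
    refine (Finset.sum_le_card_nsmul _ _ _ hterm).trans ?_
    rw [nsmul_eq_mul]
    have hcard' : ((((Finset.range (N + 1)).filter (fun k => Y k = 0)).card : ℕ) : ℝ) ≤ 1 := by
      exact_mod_cast hcard
    nlinarith [Real.exp_pos K]
  have hcenter0 : 0 ≤ ∑ k ∈ (Finset.range (N + 1)).filter (fun k => Y k = 0), w k :=
    Finset.sum_nonneg fun k _ => hw0 k
  have hneg : ∀ k, 0 < -Y k ↔ Y k < 0 := fun k => neg_pos
  simp only [pow_zero, pow_one, one_mul, neg_mul, ne_eq, OfNat.ofNat_ne_zero,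
    not_false_eq_true, zero_pow, neg_zero, zero_div, Real.exp_zero, add_zero] at h0 h1
  change |_ * ∑ k ∈ (Finset.range (N + 1)).filter (fun k => 0 < Y k), w k - _| ≤ _ at h0
  change |_ * ∑ k ∈ (Finset.range (N + 1)).filter (fun k => 0 < -Y k), w k - _| ≤ _ at h1
  simp only [hneg] at h1
  have hc1 : |2 * Real.sqrt a / ν *
      ∑ k ∈ (Finset.range (N + 1)).filter (fun k => Y k = 0), w k| ≤
      2 * Real.sqrt a / ν * Real.exp K := by
    rw [abs_of_nonneg (by positivity)]
    gcongr
  rw [hsplit, ← two_mul_gaussLaplace_zero]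
  have e : ∀ A B D d R : ℝ, d * (A + B + D) - 2 * R = (d * A - R) + (d * B - R) + d * D :=
    fun A B D d R => by ring
  rw [e]
  refine (abs_add_three _ _ _).trans ((add_le_add (add_le_add h0 h1) hc1).trans (le_of_eq ?_))
  ring

lemma abs_ratio_sub_one_le {q z g s t L L' : ℝ} (hg : 0 < g) (hs : 0 < s)
    (hq : |q - g| ≤ L * t * g) (hz : |z - s| ≤ L' * t) (hz2 : s / 2 ≤ z) :
    |q / z / (g / s) - 1| ≤ (L + L' / s) * 2 * t := by
  have hz0 : 0 < z := by linarith
  have e : q / z / (g / s) - 1 = (s * (q - g) + g * (s - z)) / (z * g) := by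
    field_simp
    ring
  rw [e, abs_div, abs_of_pos (mul_pos hz0 hg), div_le_iff₀ (mul_pos hz0 hg)]
  have h1 : |s * (q - g) + g * (s - z)| ≤ s * (L * t * g) + g * (L' * t) := by
    refine (abs_add_le _ _).trans ?_
    rw [abs_mul, abs_mul, abs_of_pos hs, abs_of_pos hg, abs_sub_comm s z]
    gcongr
  refine h1.trans ?_
  have hLt : 0 ≤ L * t := by
    by_contra hc
    push Not at hc
    have := mul_neg_of_neg_of_pos hc hg
    linarith [abs_nonneg (q - g)]
  have hLt' : 0 ≤ L' * t := (abs_nonneg _).trans hz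
  calc s * (L * t * g) + g * (L' * t) = (L * t + L' * t / s) * 2 * g * (s / 2) := by field_simp
    _ ≤ (L * t + L' * t / s) * 2 * g * z := by gcongr
    _ = _ := by ring

lemma cwProb_nonneg (p N : ℕ) (β h : ℝ) (E : Set (Fin N → Bool)) : 0 ≤ cwProb p N β h E :=
  div_nonneg (Finset.sum_nonneg fun _ _ => Set.indicator_nonneg (fun _ _ => (Real.exp_pos _).le) _)
    (Finset.sum_nonneg fun _ _ => (Real.exp_pos _).le)

lemma cwProb_le_one (p N : ℕ) (β h : ℝ) (E : Set (Fin N → Bool)) : cwProb p N β h E ≤ 1 :=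
  div_le_one_of_le₀
    (Finset.sum_le_sum fun x _ => Set.indicator_le_self' (fun _ _ => (Real.exp_pos _).le) x)
    (Finset.sum_nonneg fun _ _ => (Real.exp_pos _).le)

lemma exp_le_one_sub_stdNormCDF {x : ℝ} (hx : 0 ≤ x) :
    Real.exp (-x ^ 2 - 2) / Real.sqrt (2 * Real.pi) ≤ 1 - stdNormCDF x := by
  rw [one_sub_stdNormCDF]
  gcongr
  exact exp_neg_sq_sub_two_le hx

lemma pow_three_le_sqrt {N : ℕ} {x : ℝ} (hx : 0 ≤ x)
    (h : x ≤ (N : ℝ) ^ ((1 : ℝ) / 6)) : x ^ 3 ≤ Real.sqrt N := by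
  have h1 : ((N : ℝ) ^ ((1 : ℝ) / 6)) ^ 3 = Real.sqrt N := by
    rw [← Real.rpow_natCast, ← Real.rpow_mul (by positivity), Real.sqrt_eq_rpow]
    norm_num
  rw [← h1]
  gcongr

lemma rpow_sixth_le_sqrt {N : ℕ} (hN : 1 ≤ N) : (N : ℝ) ^ ((1 : ℝ) / 6) ≤ Real.sqrt N := by
  rw [Real.sqrt_eq_rpow]
  exact Real.rpow_le_rpow_of_exponent_le (by exact_mod_cast hN) (by norm_num)

/-- **Moderate deviations at `p`-regular points.** -/
theorem moderate_deviation_regular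
    (p : ℕ) (hp : 3 ≤ p) (β h m : ℝ) (hβ : 0 < β) (hh : 0 < h)
    (hreg : pRegular p β h m) :
    ∃ C : ℝ, 0 < C ∧ ∃ C' : ℝ, 0 < C' ∧
      ∀ N : ℕ, 1 ≤ N → ∀ r ∈ ({0, 1} : Set ℕ), ∀ x : ℝ,
        0 ≤ x → x ≤ C * (N : ℝ) ^ ((1:ℝ)/6) →
        |cwProb p N β h
            {σ | (-1 : ℝ) ^ r * (mag σ - N * m) /
                Real.sqrt (-(N : ℝ) / iteratedDeriv 2 (Hfun p β h) m) > x} /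
            (1 - stdNormCDF x) - 1|
          ≤ C' * (1 + x ^ 3) * (N : ℝ) ^ (-(1:ℝ)/2) := by
  obtain ⟨hm, hneg⟩ := hreg
  obtain ⟨a, ha2⟩ : ∃ a, iteratedDeriv 2 (Hfun p β h) m = -a := ⟨_, (neg_neg _).symm⟩
  have ha : 0 < a := by rw [ha2] at hneg; linarith
  obtain ⟨C, hC, L, hL, htail⟩ := exists_magWeight_tail hβ hh hm ha ha2
  obtain ⟨L', hL', htotal⟩ := exists_magWeight_total hβ hh hm ha ha2
  have hs : 0 < Real.sqrt (2 * Real.pi) := by positivity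
  set s := Real.sqrt (2 * Real.pi) with hs_def
  set ν₀ := 2 * L' / s with hν₀
  have hν₀pos : 0 < ν₀ := by positivity
  refine ⟨min C 1, by positivity,
    (L + L' / s) * 2 + (s * Real.exp (ν₀ ^ 2 + 2) + 1) * ν₀, by positivity, ?_⟩
  intro N hN r hr x hx hxC
  have hN1 : (1 : ℝ) ≤ N := by exact_mod_cast hN
  have hν1 : 1 ≤ Real.sqrt N := Real.one_le_sqrt.2 hN1
  have hx6 : x ≤ (N : ℝ) ^ ((1 : ℝ) / 6) :=
    hxC.trans (mul_le_of_le_one_left (by positivity) (min_le_right _ _))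
  have hxCν : x ≤ C * Real.sqrt N :=
    hxC.trans (mul_le_mul (min_le_left _ _) (rpow_sixth_le_sqrt hN) (by positivity) hC.le)
  have hxν : x ≤ Real.sqrt N := hx6.trans (rpow_sixth_le_sqrt hN)
  have hx3 := pow_three_le_sqrt hx hx6
  have hpow : (N : ℝ) ^ (-(1 : ℝ) / 2) = 1 / Real.sqrt N := by
    rw [neg_div, Real.rpow_neg (by positivity), Real.sqrt_eq_rpow, one_div ((N : ℝ) ^ _)]
  rw [hpow, ha2, neg_div_neg_eq, mul_assoc, mul_one_div, add_mul]
  have ht : 0 < (1 + x ^ 3) / Real.sqrt N := by positivity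
  have h1t : 1 / Real.sqrt N ≤ (1 + x ^ 3) / Real.sqrt N := by
    gcongr
    have : 0 ≤ x ^ 3 := by positivity
    linarith
  by_cases hlarge : ν₀ ≤ Real.sqrt N
  · have hq := htail N hN r hr x hx hxCν hx3
    have hz := htotal N hN
    have hA : 0 < magConst p N β h m := Real.exp_pos _
    have hz2 : L' / Real.sqrt N ≤ s / 2 := by
      rw [div_le_iff₀ (by linarith)]
      rw [hν₀, div_le_iff₀ hs] at hlarge
      linarith
    have hratio := abs_ratio_sub_one_le
      (mul_pos (Real.exp_pos (-x ^ 2 / 2)) (gaussLaplace_half_pos hx)) hs hq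
      (t := (1 + x ^ 3) / Real.sqrt N) (L' := L')
      (hz.trans (by rw [← mul_one_div]; gcongr)) (by linarith [(abs_le.1 hz).1])
    have hcw := cwProb_eq (p := p) hN β h
      (fun M => (-1 : ℝ) ^ r * (M - N * m) / Real.sqrt (N / a) > x)
    have hΔ : 0 < 2 * Real.sqrt a / Real.sqrt N := by positivity
    rw [hcw, one_sub_stdNormCDF]
    simp only [gt_iff_lt, mul_div_assoc]
    rw [← Finset.sum_div, ← Finset.sum_div, mul_div_mul_left _ _ hΔ.ne',
      div_div_div_cancel_right₀ hA.ne'] at hratio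
    simp only [mul_div_assoc] at hratio
    refine hratio.trans (le_add_of_nonneg_right (by positivity))
  · push Not at hlarge
    set P := cwProb p N β h {σ | (-1 : ℝ) ^ r * (mag σ - N * m) / Real.sqrt (N / a) > x} with hP
    have hP0 : 0 ≤ P := cwProb_nonneg _ _ _ _ _
    have hP1 : P ≤ 1 := cwProb_le_one _ _ _ _ _
    have hΦ := exp_le_one_sub_stdNormCDF hx
    have hlow : 0 < Real.exp (-x ^ 2 - 2) / s := by positivity
    have hquot : P / (1 - stdNormCDF x) ≤ s * Real.exp (ν₀ ^ 2 + 2) := by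
      calc P / (1 - stdNormCDF x) ≤ 1 / (Real.exp (-x ^ 2 - 2) / s) := by gcongr
        _ = s * Real.exp (x ^ 2 + 2) := by
          rw [one_div_div, show -x ^ 2 - 2 = -(x ^ 2 + 2) by ring, Real.exp_neg, div_inv_eq_mul]
        _ ≤ s * Real.exp (ν₀ ^ 2 + 2) := by
          have : x ≤ ν₀ := by linarith
          gcongr
    have hquot0 : 0 ≤ P / (1 - stdNormCDF x) := div_nonneg hP0 (hlow.le.trans hΦ)
    have hone : 1 ≤ ν₀ * ((1 + x ^ 3) / Real.sqrt N) := by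
      calc 1 ≤ ν₀ * (1 / Real.sqrt N) := by
            rw [mul_one_div, one_le_div (by linarith)]; exact hlarge.le
        _ ≤ _ := by gcongr
    have hB : 0 < s * Real.exp (ν₀ ^ 2 + 2) + 1 := by positivity
    calc |P / (1 - stdNormCDF x) - 1| ≤ s * Real.exp (ν₀ ^ 2 + 2) + 1 := by
          rw [abs_le]; constructor <;> linarith
      _ ≤ (s * Real.exp (ν₀ ^ 2 + 2) + 1) * (ν₀ * ((1 + x ^ 3) / Real.sqrt N)) :=
          le_mul_of_one_le_right hB.le hone
      _ = (s * Real.exp (ν₀ ^ 2 + 2) + 1) * ν₀ * ((1 + x ^ 3) / Real.sqrt N) := by ring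
      _ ≤ _ := le_add_of_nonneg_left (by positivity)
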